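/- arXiv:1302.5889 — 3 statements merged into one kernel-verified Lean document; each statement's English description precedes it below -/
import Mathlib

section
/- Let G be a connected weighted partial 2-tree that is not outerplanar, let {u,v} be a vertex separator of G such that G − {u,v} has at least three components, let H be a component of G − {u,v} with V(lsp(u,v)) ∩ V(H) = ∅ and E(lsp(u,v)) ∩ E(H) = ∅, and let G₁, G₂ be obtained by decomp(G,u,v). Then LSC(G) is the disjoint union of LSC(G₁) and LSC(G₂): every lex short cycle of G lies in exactly one of G₁, G₂ and is a lex short cycle there, and conversely every lex short cycle of G₁ or of G₂ is a lex short cycle of G, and LSC(G₁) ∩ LSC(G₂) = ∅. -/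
/-!
Common definitions for formalizing "Minimum Cycle Basis in Weighted Partial 2-trees".
-/

namespace LexMCB

open SimpleGraph

variable {V : Type*}

/-- The weight of a walk: the sum of the weights of its edges. -/
def walkWeight {G : SimpleGraph V} (w : Sym2 V → ℕ) {a b : V} (p : G.Walk a b) : ℕ :=
  (p.edges.map w).sum

/-- A walk is contained in the subgraph described by vertex set `V₁` and edge set `E₁`. -/
def WalkIn {G : SimpleGraph V} (V₁ : Set V) (E₁ : Set (Sym2 V)) {a b : V}
    (p : G.Walk a b) : Prop :=
  (∀ t ∈ p.support, t ∈ V₁) ∧ ∀ e ∈ p.edges, e ∈ E₁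

/-- `p` is lexicographically better than `q`: either it has smaller weight, or equal weight
and fewer edges, or equal weight and equally many edges and
`min (V(q) \ V(p)) > min (V(p) \ V(q))`. -/
def LexBetter [LinearOrder V] {G : SimpleGraph V} (w : Sym2 V → ℕ) {a b : V}
    (p q : G.Walk a b) : Prop :=
  walkWeight w p < walkWeight w q ∨
    (walkWeight w q = walkWeight w p ∧ p.length < q.length) ∨
    (walkWeight w q = walkWeight w p ∧ q.length = p.length ∧
      (p.support.toFinset \ q.support.toFinset).min <
        (q.support.toFinset \ p.support.toFinset).min)

/-- `p` is the lex shortest path between its endpoints among the paths lying in the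
subgraph described by vertex set `V₁` and edge set `E₁`. -/
def IsLexShortestPathIn [LinearOrder V] {G : SimpleGraph V} (w : Sym2 V → ℕ)
    (V₁ : Set V) (E₁ : Set (Sym2 V)) {a b : V} (p : G.Walk a b) : Prop :=
  p.IsPath ∧ WalkIn V₁ E₁ p ∧
    ∀ q : G.Walk a b, q.IsPath → WalkIn V₁ E₁ q → q ≠ p → LexBetter w p q

/-- `p` is the lex shortest path of `G` between its endpoints. -/
def IsLexShortestPath [LinearOrder V] {G : SimpleGraph V} (w : Sym2 V → ℕ)
    {a b : V} (p : G.Walk a b) : Prop :=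
  IsLexShortestPathIn w Set.univ G.edgeSet p

/-- A (sub)graph is a cycle: it is connected and every vertex has degree two. -/
def IsCycleSubgraph {G : SimpleGraph V} (C : G.Subgraph) : Prop :=
  C.Connected ∧ ∀ t ∈ C.verts, (C.neighborSet t).ncard = 2

/-- `C` is a lex short cycle of the subgraph of `G` described by vertex set `V₁` and
edge set `E₁`: it is a cycle lying there, and for any two distinct vertices `x,y` of `C`
the lex shortest `x`-`y` path of that subgraph is contained in `C`. -/
def IsLexShortCycleIn [LinearOrder V] {G : SimpleGraph V} (w : Sym2 V → ℕ)
    (V₁ : Set V) (E₁ : Set (Sym2 V)) (C : G.Subgraph) : Prop :=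
  C.verts ⊆ V₁ ∧ C.edgeSet ⊆ E₁ ∧ IsCycleSubgraph C ∧
    ∀ x ∈ C.verts, ∀ y ∈ C.verts, x ≠ y →
      ∀ p : G.Walk x y, IsLexShortestPathIn w V₁ E₁ p → ∀ e ∈ p.edges, e ∈ C.edgeSet

/-- The set of lex short cycles of the subgraph of `G` described by `V₁`, `E₁`. -/
def LSCIn [LinearOrder V] (G : SimpleGraph V) (w : Sym2 V → ℕ)
    (V₁ : Set V) (E₁ : Set (Sym2 V)) : Set G.Subgraph :=
  {C | IsLexShortCycleIn w V₁ E₁ C}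

/-- The set of lex short cycles of `G`. -/
def LSC [LinearOrder V] (G : SimpleGraph V) (w : Sym2 V → ℕ) : Set G.Subgraph :=
  LSCIn G w Set.univ G.edgeSet

/-! ### Components and separators -/

/-- The edges of `G` lying within the vertex set `H`. -/
def edgesWithin (G : SimpleGraph V) (H : Set V) : Set (Sym2 V) :=
  {e | e ∈ G.edgeSet ∧ ∀ t ∈ e, t ∈ H}

/-- `H` is (the vertex set of) a connected component of the induced subgraph `G[A]`:
it is a maximal subset of `A` inducing a connected subgraph. -/
def IsComponentOf (G : SimpleGraph V) (A : Set V) (H : Set V) : Prop :=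
  H.Nonempty ∧ H ⊆ A ∧ (G.induce H).Connected ∧
    ∀ K : Set V, H ⊆ K → K ⊆ A → (G.induce K).Connected → K = H

/-- `{u, v}` is a vertex separator of `G` : deleting `u` and `v` disconnects `G`. -/
def IsSeparatorPair (G : SimpleGraph V) (u v : V) : Prop :=
  ¬ (G.induce {t | t ≠ u ∧ t ≠ v}).Connected

/-- The number of connected components of `G - {u, v}`. -/
noncomputable def numComponentsDel (G : SimpleGraph V) (u v : V) : ℕ :=
  Nat.card ((G.induce {t | t ≠ u ∧ t ≠ v}).ConnectedComponent)

/-! ### Subdivisions of `K₄` and `K_{2,3}`, outerplanarity -/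

/-- The interior (internal vertices) of a walk. -/
def walkInterior {G : SimpleGraph V} {a b : V} (p : G.Walk a b) : Set V :=
  {t | t ∈ p.support} \ {a, b}

/-- A `K_{2,3}`-subdivision in `G` with branch vertices `u, v` (the side of size two)
and `x, y, z` (the side of size three): six internally disjoint paths joining each of
`u, v` to each of `x, y, z`, whose interiors avoid the branch vertices. -/
structure K23Subdiv (G : SimpleGraph V) (u v x y z : V) where
  pux : G.Walk u x
  puy : G.Walk u y
  puz : G.Walk u z
  pvx : G.Walk v x
  pvy : G.Walk v y
  pvz : G.Walk v z
  branch_nodup : List.Pairwise (· ≠ ·) [u, v, x, y, z]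
  isPath_pux : pux.IsPath
  isPath_puy : puy.IsPath
  isPath_puz : puz.IsPath
  isPath_pvx : pvx.IsPath
  isPath_pvy : pvy.IsPath
  isPath_pvz : pvz.IsPath
  interiors_disjoint : List.Pairwise Disjoint
    [walkInterior pux, walkInterior puy, walkInterior puz,
     walkInterior pvx, walkInterior pvy, walkInterior pvz]
  interiors_avoid_branch : ∀ s ∈ [walkInterior pux, walkInterior puy, walkInterior puz,
      walkInterior pvx, walkInterior pvy, walkInterior pvz],
    ∀ t ∈ s, t ∉ ({u, v, x, y, z} : Set V)

/-- The vertex set of a `K_{2,3}`-subdivision. -/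
def K23Subdiv.vertSet {G : SimpleGraph V} {u v x y z : V} (K : K23Subdiv G u v x y z) :
    Set V :=
  {t | t ∈ K.pux.support ∨ t ∈ K.puy.support ∨ t ∈ K.puz.support ∨
       t ∈ K.pvx.support ∨ t ∈ K.pvy.support ∨ t ∈ K.pvz.support}

/-- The edge set of a `K_{2,3}`-subdivision. -/
def K23Subdiv.edges {G : SimpleGraph V} {u v x y z : V} (K : K23Subdiv G u v x y z) :
    Set (Sym2 V) :=
  {e | e ∈ K.pux.edges ∨ e ∈ K.puy.edges ∨ e ∈ K.puz.edges ∨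
       e ∈ K.pvx.edges ∨ e ∈ K.pvy.edges ∨ e ∈ K.pvz.edges}

/-- `G` contains a subdivision of `K_{2,3}`. -/
def HasK23Subdivision (G : SimpleGraph V) : Prop :=
  ∃ u v x y z : V, Nonempty (K23Subdiv G u v x y z)

/-- The subgraph `S` of `G` is (exactly) a `K_{2,3}`-subdivision. -/
def IsK23SubdivisionSubgraph {G : SimpleGraph V} (S : G.Subgraph) : Prop :=
  ∃ (u v x y z : V) (K : K23Subdiv G u v x y z),
    K.vertSet = S.verts ∧ K.edges = S.edgeSet

/-- A `K₄`-subdivision in `G` with branch vertices `a, b, c, d`. -/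
structure K4Subdiv (G : SimpleGraph V) (a b c d : V) where
  pab : G.Walk a b
  pac : G.Walk a c
  pad : G.Walk a d
  pbc : G.Walk b c
  pbd : G.Walk b d
  pcd : G.Walk c d
  branch_nodup : List.Pairwise (· ≠ ·) [a, b, c, d]
  isPath_pab : pab.IsPath
  isPath_pac : pac.IsPath
  isPath_pad : pad.IsPath
  isPath_pbc : pbc.IsPath
  isPath_pbd : pbd.IsPath
  isPath_pcd : pcd.IsPath
  interiors_disjoint : List.Pairwise Disjoint
    [walkInterior pab, walkInterior pac, walkInterior pad,
     walkInterior pbc, walkInterior pbd, walkInterior pcd]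
  interiors_avoid_branch : ∀ s ∈ [walkInterior pab, walkInterior pac, walkInterior pad,
      walkInterior pbc, walkInterior pbd, walkInterior pcd],
    ∀ t ∈ s, t ∉ ({a, b, c, d} : Set V)

/-- `G` contains a subdivision of `K₄`. -/
def HasK4Subdivision (G : SimpleGraph V) : Prop :=
  ∃ a b c d : V, Nonempty (K4Subdiv G a b c d)

/-- `G` is outerplanar.  (We use the classical combinatorial characterization:
a graph is outerplanar iff it has no subgraph that is a subdivision of `K₄` or of
`K_{2,3}`.) -/
def IsOuterplanar (G : SimpleGraph V) : Prop :=
  ¬ HasK4Subdivision G ∧ ¬ HasK23Subdivision G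

/-! ### 2-trees and partial 2-trees -/

/-- Add to `G` a new vertex adjacent to (exactly) `a` and `b`. -/
def addVertexOnEdge {n : ℕ} (G : SimpleGraph (Fin n)) (a b : Fin n) :
    SimpleGraph (Fin (n + 1)) :=
  SimpleGraph.fromRel fun i j =>
    (∃ i' j' : Fin n, i = Fin.castSucc i' ∧ j = Fin.castSucc j' ∧ G.Adj i' j') ∨
    (i = Fin.last n ∧ (j = Fin.castSucc a ∨ j = Fin.castSucc b))

/-- 2-trees, defined inductively: `K₃` is a 2-tree, and adding a new vertex whose
neighbourhood is an edge of a 2-tree again gives a 2-tree. -/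
inductive IsTwoTree : ∀ {n : ℕ}, SimpleGraph (Fin n) → Prop
  | base : IsTwoTree (⊤ : SimpleGraph (Fin 3))
  | extend {n : ℕ} (G : SimpleGraph (Fin n)) (a b : Fin n) :
      IsTwoTree G → G.Adj a b → IsTwoTree (addVertexOnEdge G a b)

/-- A partial 2-tree: a subgraph of a 2-tree. -/
def IsPartialTwoTree {W : Type*} (G : SimpleGraph W) : Prop :=
  ∃ (n : ℕ) (T : SimpleGraph (Fin n)) (f : W ↪ Fin n),
    IsTwoTree T ∧ ∀ x y : W, G.Adj x y → T.Adj (f x) (f y)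

/-! ### The cycle space over `𝔽₂`, cycle bases and minimum cycle bases -/

/-- The incidence vector (over `𝔽₂`) of a subgraph, indexed by `Sym2 V`. -/
noncomputable def cycleIncVec {G : SimpleGraph V} (C : G.Subgraph) : Sym2 V → ZMod 2 :=
  C.edgeSet.indicator fun _ => 1

/-- The cycle space of `G`: the span over `𝔽₂` of the incidence vectors of cycles. -/
def cycleSpace (G : SimpleGraph V) : Submodule (ZMod 2) (Sym2 V → ZMod 2) :=
  Submodule.span (ZMod 2) (cycleIncVec '' {C : G.Subgraph | IsCycleSubgraph C})

/-- `B` is a cycle basis of `G`: a minimum-cardinality set of cycles whose incidence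
vectors span the cycle space of `G`. -/
def IsCycleBasis (G : SimpleGraph V) (B : Set G.Subgraph) : Prop :=
  (∀ C ∈ B, IsCycleSubgraph C) ∧
    Submodule.span (ZMod 2) (cycleIncVec '' B) = cycleSpace G ∧
    ∀ B' : Set G.Subgraph, (∀ C ∈ B', IsCycleSubgraph C) →
      Submodule.span (ZMod 2) (cycleIncVec '' B') = cycleSpace G → B.ncard ≤ B'.ncard

/-- The weight of a cycle: the sum of the weights of its edges. -/
noncomputable def cycleWeight {G : SimpleGraph V} (w : Sym2 V → ℕ) (C : G.Subgraph) : ℕ :=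
  ∑ᶠ e ∈ C.edgeSet, w e

/-- The total weight of a set of cycles. -/
noncomputable def basisWeight {G : SimpleGraph V} (w : Sym2 V → ℕ)
    (B : Set G.Subgraph) : ℕ :=
  ∑ᶠ C ∈ B, cycleWeight w C

/-- `B` is a minimum cycle basis of `G`: a cycle basis of minimum total weight. -/
def IsMinimumCycleBasis (G : SimpleGraph V) (w : Sym2 V → ℕ) (B : Set G.Subgraph) : Prop :=
  IsCycleBasis G B ∧ ∀ B' : Set G.Subgraph, IsCycleBasis G B' →
    basisWeight w B ≤ basisWeight w B'

/-! ### The `decomp` operation -/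

/-- The vertex set of the first part `G₁` of `decomp(G,u,v)`. -/
def decompVerts1 {G : SimpleGraph V} {u v : V} (P : G.Walk u v) (H : Set V) : Set V :=
  H ∪ {t | t ∈ P.support}

/-- The edge set of the first part `G₁` of `decomp(G,u,v)`:
`E(H) ∪ E(lsp(u,v)) ∪ {(x,y) : x ∈ V(H), y ∈ {u,v}, (x,y) ∈ E(G)}`. -/
def decompEdges1 {G : SimpleGraph V} {u v : V} (P : G.Walk u v) (H : Set V) :
    Set (Sym2 V) :=
  edgesWithin G H ∪ {e | e ∈ P.edges} ∪
    {e | ∃ a ∈ H, ∃ c ∈ ({u, v} : Set V), G.Adj a c ∧ e = s(a, c)}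


/-! ### Walks of least weight, with ties broken by the number of edges -/

section Cheapest

variable {G : SimpleGraph V} {w : Sym2 V → ℕ} {a b c : V}

theorem walkWeight_cons (h : G.Adj a b) (p : G.Walk b c) :
    walkWeight w (p.cons h) = w s(a, b) + walkWeight w p := by
  simp [walkWeight]

theorem walkWeight_append (p : G.Walk a b) (q : G.Walk b c) :
    walkWeight w (p.append q) = walkWeight w p + walkWeight w q := by
  simp [walkWeight]

theorem walkWeight_reverse (p : G.Walk a b) : walkWeight w p.reverse = walkWeight w p := by
  simp [walkWeight]

theorem walkWeight_bypass_le [DecidableEq V] (p : G.Walk a b) :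
    walkWeight w p.bypass ≤ walkWeight w p :=
  (p.edges_bypass_sublist_edges.map w).sum_le_sum (by simp)

/-- `p` has least weight among all walks with the same endpoints, and fewest edges among those
of least weight. -/
def IsCheapest (w : Sym2 V → ℕ) (p : G.Walk a b) : Prop :=
  ∀ q : G.Walk a b,
    walkWeight w p < walkWeight w q ∨ walkWeight w p = walkWeight w q ∧ p.length ≤ q.length

theorem IsCheapest.of_append_right {p : G.Walk a b} {q : G.Walk b c}
    (h : IsCheapest w (p.append q)) : IsCheapest w q := by
  intro q'
  have := h (p.append q')
  simp only [walkWeight_append, Walk.length_append] at this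
  omega

theorem IsCheapest.of_cons {h : G.Adj a b} {p : G.Walk b c} (hp : IsCheapest w (p.cons h)) :
    IsCheapest w p := by
  intro q
  have := hp (q.cons h)
  simp only [walkWeight_cons, Walk.length_cons] at this
  omega

theorem IsCheapest.isPath {p : G.Walk a b} (hp : IsCheapest w p) : p.IsPath := by
  classical
  have h := hp p.bypass
  have h' := walkWeight_bypass_le (w := w) p
  rw [← Walk.bypass_eq_self_of_length_le_length_bypass p (by omega)]
  exact p.bypass_isPath

/-- A cheapest walk is determined by its vertex set. -/
theorem IsCheapest.eq_of_support {p q : G.Walk a b} (hp : IsCheapest w p) (hq : IsCheapest w q)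
    (h : ∀ t, t ∈ p.support ↔ t ∈ q.support) : p = q := by
  induction p with
  | nil => exact ((Walk.isPath_iff_nil).1 hq.isPath).eq_nil.symm
  | @cons a c b hac p ih =>
    have hpp := (Walk.cons_isPath_iff _ _).1 hp.isPath
    cases q with
    | nil => exact absurd p.end_mem_support hpp.2
    | @cons _ d _ had q =>
      have hqp := (Walk.cons_isPath_iff _ _).1 hq.isPath
      have hsupp : ∀ t, t ∈ p.support ↔ t ∈ q.support := by
        intro t
        have := h t
        simp only [Walk.support_cons, List.mem_cons] at this
        by_cases hta : t = a
        · subst hta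
          exact iff_of_false hpp.2 hqp.2
        · simpa [hta] using this
      by_cases hcd : c = d
      · subst hcd
        rw [ih hp.of_cons hq.of_cons hsupp]
      · obtain ⟨q₁, q₂, hq₁₂⟩ :=
          Walk.mem_support_iff_exists_append.1 ((hsupp c).1 p.start_mem_support)
        obtain ⟨p₁, p₂, hp₁₂⟩ :=
          Walk.mem_support_iff_exists_append.1 ((hsupp d).2 q.start_mem_support)
        have hp₁ : p₁.length ≠ 0 := fun h0 => hcd (Walk.eq_of_length_eq_zero h0)
        have hq₁ : q₁.length ≠ 0 := fun h0 => hcd (Walk.eq_of_length_eq_zero h0).symm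
        have h₁ := hp.of_cons q₂
        have h₂ := hq.of_cons p₂
        subst hp₁₂ hq₁₂
        simp only [walkWeight_append, Walk.length_append] at h₁ h₂
        omega

end Cheapest

/-! ### Lex shortest paths -/

section LexShortest

variable [LinearOrder V] {G : SimpleGraph V} {w : Sym2 V → ℕ} {a b c : V}

theorem isLexShortestPath_iff {p : G.Walk a b} :
    IsLexShortestPath w p ↔
      p.IsPath ∧ ∀ q : G.Walk a b, q.IsPath → q ≠ p → LexBetter w p q := by
  have hin : ∀ q : G.Walk a b, WalkIn Set.univ G.edgeSet q := fun q =>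
    ⟨fun _ _ => trivial, fun _ he => q.edges_subset_edgeSet he⟩
  simp [IsLexShortestPath, IsLexShortestPathIn, hin]

theorem LexBetter.asymm {p q : G.Walk a b} (h : LexBetter w p q) : ¬ LexBetter w q p := by
  rintro h'
  rcases h with h | h | ⟨h₁, h₂, h₃⟩ <;> rcases h' with h' | h' | ⟨h₁', h₂', h₃'⟩ <;>
    first | omega | exact lt_asymm h₃ h₃'

theorem IsLexShortestPathIn.eq {V₁ : Set V} {E₁ : Set (Sym2 V)} {p q : G.Walk a b}
    (hp : IsLexShortestPathIn w V₁ E₁ p) (hq : IsLexShortestPathIn w V₁ E₁ q) : p = q := by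
  by_contra hne
  exact (hp.2.2 q hq.1 hq.2.1 (Ne.symm hne)).asymm (hq.2.2 p hp.1 hp.2.1 hne)

theorem IsLexShortestPath.isPath {p : G.Walk a b} (hp : IsLexShortestPath w p) : p.IsPath :=
  hp.1

theorem IsLexShortestPath.isCheapest {p : G.Walk a b} (hp : IsLexShortestPath w p) :
    IsCheapest w p := by
  intro q
  have hw := walkWeight_bypass_le (w := w) q
  have hl := q.length_bypass_le_length
  by_cases hqp : q.bypass = p
  · rw [hqp] at hw hl
    omega
  · rcases (isLexShortestPath_iff.1 hp).2 _ q.bypass_isPath hqp with h | h | h <;> omega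

theorem IsLexShortestPath.reverse {p : G.Walk a b} (hp : IsLexShortestPath w p) :
    IsLexShortestPath w p.reverse := by
  rw [isLexShortestPath_iff] at hp ⊢
  refine ⟨hp.1.reverse, fun q hq hne => ?_⟩
  have := hp.2 q.reverse hq.reverse (by rintro rfl; simp at hne)
  simpa [LexBetter, walkWeight_reverse] using this

theorem IsLexShortestPath.of_append_right {p : G.Walk a b} {q : G.Walk b c}
    (h : IsLexShortestPath w (p.append q)) : IsLexShortestPath w q := by
  have hq := h.isCheapest.of_append_right
  refine isLexShortestPath_iff.2 ⟨hq.isPath, fun q' hq' hne => ?_⟩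
  have hle := hq q'
  have hbetter : (∀ r : G.Walk a c, r.IsPath → r ≠ p.append q → LexBetter w (p.append q) r) :=
    (isLexShortestPath_iff.1 h).2
  by_cases hcost : walkWeight w q = walkWeight w q' ∧ q.length = q'.length
  · have hcheap : IsCheapest w (p.append q') := by
      intro r
      have := h.isCheapest r
      simp only [walkWeight_append, Walk.length_append] at this ⊢
      omega
    have hshare : ∀ {r : G.Walk b c}, (p.append r).IsPath → ∀ t ∈ p.support, t ∈ r.support →
        t = b := by
      intro r hr t htp htr
      by_contra htb
      exact hr.ne_of_mem_support_of_append htb htp htr rfl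
    have hsdiff : ∀ {r r' : G.Walk b c}, (p.append r).IsPath →
        (p.append r).support.toFinset \ (p.append r').support.toFinset =
          r.support.toFinset \ r'.support.toFinset := by
      intro r r' hr
      ext t
      simp only [Finset.mem_sdiff, List.mem_toFinset, Walk.mem_support_append_iff]
      constructor
      · tauto
      · rintro ⟨htr, htr'⟩
        refine ⟨.inr htr, fun ht => ht.elim (fun htp => htr' ?_) htr'⟩
        rw [hshare hr t htp htr]
        exact r'.start_mem_support
    have := hbetter _ hcheap.isPath (fun heq => hne ?_)
    · rw [LexBetter, hsdiff h.isPath, hsdiff hcheap.isPath] at this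
      simpa only [LexBetter, walkWeight_append, Walk.length_append, add_right_inj, add_lt_add_iff_left]
        using this
    · apply Walk.ext_support
      have := congrArg Walk.support heq
      rw [Walk.support_append_eq_support_dropLast_append,
        Walk.support_append_eq_support_dropLast_append] at this
      exact List.append_cancel_left this
  · rcases hle with hle | hle
    · exact .inl hle
    · exact .inr (.inl (by omega))

theorem IsLexShortestPath.of_append_left {p : G.Walk a b} {q : G.Walk b c}
    (h : IsLexShortestPath w (p.append q)) : IsLexShortestPath w p := by
  have := h.reverse
  rw [Walk.reverse_append] at this
  simpa using this.of_append_right.reverse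

/-- The lexicographic rank of a vertex set; smaller ranks are preferred by `LexBetter`. -/
def lexRank (s : Finset V) : Lex (V → Bool) :=
  toLex fun t => decide (t ∉ s)

theorem min_sdiff_lt_of_lexRank_lt {s t : Finset V} (h : lexRank s < lexRank t) :
    (s \ t).min < (t \ s).min := by
  obtain ⟨i, hlt, hi⟩ := h
  have hlt : ∀ j < i, j ∈ s ↔ j ∈ t := fun j hj => by
    have := hlt j hj
    simpa only [lexRank, Pi.toLex_apply, decide_eq_decide, not_iff_not] using this
  have hi : i ∈ s ∧ i ∉ t := by
    simpa [lexRank, Bool.lt_iff] using hi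
  refine lt_of_le_of_lt (Finset.min_le (Finset.mem_sdiff.2 hi)) ?_
  cases hj : (t \ s).min with
  | top => exact WithTop.coe_lt_top i
  | coe j =>
    have hj := Finset.mem_sdiff.1 (Finset.mem_of_min hj)
    rw [WithTop.coe_lt_coe]
    refine lt_of_le_of_ne (not_lt.1 fun hji => hj.2 ((hlt j hji).2 hj.1)) ?_
    rintro rfl
    exact hj.2 hi.1

theorem lexRank_injective : Function.Injective (lexRank (V := V)) := by
  intro s t h
  ext i
  have := congrFun (congrArg ofLex h) i
  simpa [lexRank, not_iff_not] using this

theorem exists_isLexShortestPath [Finite V] (hab : G.Reachable a b) :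
    ∃ p : G.Walk a b, IsLexShortestPath w p := by
  classical
  have := Fintype.ofFinite V
  obtain ⟨p₀⟩ := hab
  have : Nonempty (G.Path a b) := ⟨p₀.toPath⟩
  obtain ⟨⟨p, hp⟩, hmin⟩ := Finite.exists_min fun p : G.Path a b =>
    toLex (walkWeight w p.1, toLex (p.1.length, lexRank p.1.support.toFinset))
  have hmin' : ∀ q : G.Walk a b, q.IsPath → walkWeight w p < walkWeight w q ∨
      walkWeight w p = walkWeight w q ∧ (p.length < q.length ∨
        p.length = q.length ∧ lexRank p.support.toFinset ≤ lexRank q.support.toFinset) := by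
    intro q hq
    simpa [Prod.Lex.toLex_le_toLex] using hmin ⟨q, hq⟩
  have hcheap : ∀ r : G.Walk a b, r.IsPath → walkWeight w r = walkWeight w p →
      r.length = p.length → IsCheapest w r := by
    intro r _ hw hl q
    have := walkWeight_bypass_le (w := w) q
    have := q.length_bypass_le_length
    rcases hmin' _ q.bypass_isPath with h | ⟨h, h' | h'⟩ <;> omega
  refine ⟨p, isLexShortestPath_iff.2 ⟨hp, fun q hq hne => ?_⟩⟩
  rcases hmin' q hq with h | ⟨hw, hl | ⟨hl, hr⟩⟩
  · exact .inl h
  · exact .inr (.inl ⟨hw.symm, hl⟩)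
  · refine .inr (.inr ⟨hw.symm, hl.symm, min_sdiff_lt_of_lexRank_lt (lt_of_le_of_ne hr ?_)⟩)
    intro heq
    refine hne ((hcheap q hq hw.symm hl.symm).eq_of_support (hcheap p hp rfl rfl) fun t => ?_)
    simpa using (Finset.ext_iff.1 (lexRank_injective heq) t).symm

end LexShortest

section Subpaths

variable {G : SimpleGraph V} {a b c : V}

theorem exists_append_cons_of_mem_edges {p : G.Walk a b} {e : Sym2 V} (he : e ∈ p.edges) :
    ∃ (x y : V) (h : G.Adj x y) (q : G.Walk a x) (r : G.Walk y b),
      e = s(x, y) ∧ p = q.append (r.cons h) := by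
  induction p with
  | nil => simp at he
  | cons h p ih =>
    rw [Walk.edges_cons, List.mem_cons] at he
    rcases he with rfl | he
    · exact ⟨_, _, h, .nil, p, rfl, rfl⟩
    · obtain ⟨x, y, h', q, r, rfl, rfl⟩ := ih he
      exact ⟨x, y, h', q.cons h, r, rfl, rfl⟩

variable [LinearOrder V] {w : Sym2 V → ℕ} {u v x y t : V}

/-- A lex shortest path between two vertices of a lex shortest path `P` is a segment of `P`. -/
theorem IsLexShortestPath.subset_of_mem_support {P : G.Walk u v} (hP : IsLexShortestPath w P)
    (hx : x ∈ P.support) (hy : y ∈ P.support) {T : G.Walk x y} (hT : IsLexShortestPath w T) :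
    (∀ t ∈ T.support, t ∈ P.support) ∧ ∀ e ∈ T.edges, e ∈ P.edges := by
  obtain ⟨A, B, rfl⟩ := Walk.mem_support_iff_exists_append.1 hx
  rw [Walk.mem_support_append_iff] at hy
  rcases hy with hy | hy
  · obtain ⟨A₁, A₂, rfl⟩ := Walk.mem_support_iff_exists_append.1 hy
    obtain rfl : T = A₂.reverse := hT.eq hP.of_append_left.of_append_right.reverse
    refine ⟨fun t ht => ?_, fun e he => ?_⟩ <;> simp_all
  · obtain ⟨B₁, B₂, rfl⟩ := Walk.mem_support_iff_exists_append.1 hy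
    obtain rfl : T = B₁ := hT.eq hP.of_append_right.of_append_left
    refine ⟨fun t ht => ?_, fun e he => ?_⟩ <;> simp_all

theorem IsLexShortestPath.mem_support_of_append {P : G.Walk u v} (hP : IsLexShortestPath w P)
    {T₁ : G.Walk x t} {T₂ : G.Walk t y} (hT : IsLexShortestPath w (T₁.append T₂))
    (h₁ : ∃ c ∈ T₁.support, c ∈ P.support) (h₂ : ∃ c ∈ T₂.support, c ∈ P.support) :
    t ∈ P.support := by
  obtain ⟨c₁, hc₁, hc₁P⟩ := h₁
  obtain ⟨c₂, hc₂, hc₂P⟩ := h₂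
  obtain ⟨A, B, rfl⟩ := Walk.mem_support_iff_exists_append.1 hc₁
  obtain ⟨C, D, rfl⟩ := Walk.mem_support_iff_exists_append.1 hc₂
  rw [← Walk.append_assoc, Walk.append_assoc B] at hT
  exact (hP.subset_of_mem_support hc₁P hc₂P hT.of_append_right.of_append_left).1 t (by simp)

theorem IsLexShortestPath.mem_edges_of_append {P : G.Walk u v} (hP : IsLexShortestPath w P)
    {h : G.Adj a b} {T₁ : G.Walk x a} {T₂ : G.Walk b y}
    (hT : IsLexShortestPath w (T₁.append (T₂.cons h)))
    (h₁ : ∃ c ∈ T₁.support, c ∈ P.support) (h₂ : ∃ c ∈ T₂.support, c ∈ P.support) :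
    s(a, b) ∈ P.edges := by
  obtain ⟨c₁, hc₁, hc₁P⟩ := h₁
  obtain ⟨c₂, hc₂, hc₂P⟩ := h₂
  obtain ⟨A, B, rfl⟩ := Walk.mem_support_iff_exists_append.1 hc₁
  obtain ⟨C, D, rfl⟩ := Walk.mem_support_iff_exists_append.1 hc₂
  rw [← Walk.cons_append, ← Walk.append_assoc, Walk.append_assoc B] at hT
  exact (hP.subset_of_mem_support hc₁P hc₂P hT.of_append_right.of_append_left).2 _ (by simp)

end Subpaths

/-! ### Cycles -/

section Cycles

variable {G : SimpleGraph V} {a b : V}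

theorem IsCycleSubgraph.exists_adj {C : G.Subgraph} (hC : IsCycleSubgraph C) {t : V}
    (ht : t ∈ C.verts) : ∃ s, C.Adj t s :=
  Set.nonempty_of_ncard_ne_zero (s := C.neighborSet t) (by rw [hC.2 t ht]; decide)

theorem IsCycleSubgraph.not_edgeSet_subset_edges {C : G.Subgraph} (hC : IsCycleSubgraph C)
    {p : G.Walk a b} (hp : p.IsPath) : ¬ ∀ e ∈ C.edgeSet, e ∈ p.edges := by
  induction p with
  | nil =>
    intro hsub
    obtain ⟨t, ht⟩ := hC.1.nonempty
    obtain ⟨s, hs⟩ := hC.exists_adj ht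
    simpa using hsub s(t, s) hs
  | @cons a c b h p ih =>
    intro hsub
    rw [Walk.cons_isPath_iff] at hp
    have hnbr : ∀ x, C.Adj a x → x = c := by
      intro x hx
      have := hsub s(a, x) hx
      rw [Walk.edges_cons, List.mem_cons] at this
      rcases this with h' | h'
      · exact Sym2.congr_right.1 h'
      · exact absurd (p.fst_mem_support_of_mem_edges h') hp.2
    have ha : a ∉ C.verts := by
      intro ha
      have hle := Set.ncard_le_ncard (s := C.neighborSet a) (t := {c}) (fun x hx => hnbr x hx)
      rw [hC.2 a ha, Set.ncard_singleton] at hle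
      omega
    refine ih hp.1 fun e he => ?_
    have := hsub e he
    rw [Walk.edges_cons, List.mem_cons] at this
    refine this.resolve_left ?_
    rintro rfl
    exact ha (C.edge_vert he)

theorem mem_verts_of_mem_support_spanningCoe {C : G.Subgraph} (q : C.spanningCoe.Walk a b)
    (ha : a ∈ C.verts) {t : V} (ht : t ∈ q.support) : t ∈ C.verts := by
  induction q with
  | nil => simp_all
  | cons h q ih =>
    rcases List.mem_cons.1 ht with rfl | ht
    · exact ha
    · exact ih (C.edge_vert h.symm) ht

/-- Removing an edge from a cycle leaves a path through all its vertices. -/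
theorem IsCycleSubgraph.exists_path [Finite V] {C : G.Subgraph} (hC : IsCycleSubgraph C)
    (hab : C.Adj a b) :
    ∃ q : C.spanningCoe.Walk b a, q.IsPath ∧ (∀ t ∈ C.verts, t ∈ q.support) ∧
      ∀ e ∈ C.edgeSet, e ≠ s(a, b) → e ∈ q.edges := by
  classical
  have := Fintype.ofFinite V
  have hcyc : C.spanningCoe.IsCycles := fun t ⟨s, hs⟩ => hC.2 t (C.edge_vert hs)
  obtain ⟨p, hp, hpv⟩ := hcyc.exists_cycle_toSubgraph_verts_eq_connectedComponentSupp
    (c := C.spanningCoe.connectedComponentMk a) rfl ⟨b, hab⟩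
  have hall : ∀ t ∈ C.verts, t ∈ p.support := by
    intro t ht
    rw [← Walk.mem_verts_toSubgraph, hpv]
    refine ConnectedComponent.sound ?_
    exact (hC.1.preconnected ⟨t, ht⟩ ⟨a, C.edge_vert hab⟩).map
      (⟨Subtype.val, fun h => h⟩ : C.coe →g C.spanningCoe)
  have hedges : ∀ e ∈ C.edgeSet, e ∈ p.edges := by
    intro e he
    induction e with
    | _ x y =>
      rw [← Walk.mem_edges_toSubgraph, Subgraph.mem_edgeSet]
      refine (hp.adj_toSubgraph_iff_of_isCycles hcyc ?_ y).2 he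
      exact p.mem_verts_toSubgraph.2 (hall x (C.edge_vert he))
  obtain ⟨p, hp, hall, hedges, hsnd⟩ : ∃ p : C.spanningCoe.Walk a a, p.IsCycle ∧
      (∀ t ∈ C.verts, t ∈ p.support) ∧ (∀ e ∈ C.edgeSet, e ∈ p.edges) ∧ b = p.snd := by
    have hb : b ∈ p.toSubgraph.neighborSet a := by
      rw [Subgraph.mem_neighborSet, ← Subgraph.mem_edgeSet, Walk.mem_edges_toSubgraph]
      exact hedges _ hab
    rw [hp.neighborSet_toSubgraph_endpoint] at hb
    rcases hb with hb | hb
    · exact ⟨p, hp, hall, hedges, hb⟩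
    · exact ⟨p.reverse, hp.reverse, by simpa using hall, by simpa using hedges, by simp_all⟩
  cases p with
  | nil => exact absurd rfl hp.ne_nil
  | cons h q =>
    rw [Walk.cons_isCycle_iff] at hp
    rw [Walk.snd_cons] at hsnd
    subst hsnd
    refine ⟨q, hp.1, fun t ht => ?_, fun e he hne => ?_⟩
    · rcases List.mem_cons.1 (hall t ht) with rfl | h'
      · exact q.end_mem_support
      · exact h'
    · exact (List.mem_cons.1 (hedges e he)).resolve_left hne

end Cycles

/-! ### Attachments of a component -/

section Attachments

variable {G : SimpleGraph V}

theorem IsComponentOf.mem_of_adj {A H : Set V} (hH : IsComponentOf G A H) {x y : V}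
    (hx : x ∈ H) (hy : y ∈ A) (hxy : G.Adj x y) : y ∈ H := by
  have hK := connected_induce_union hH.2.2.1.preconnected
    (Preconnected.of_subsingleton : (G.induce {y}).Preconnected) hx rfl hxy
  rw [← hH.2.2.2 _ Set.subset_union_left
    (Set.union_subset hH.2.1 (Set.singleton_subset_iff.2 hy)) hK]
  exact .inr rfl

variable {u v : V} {H : Set V}

/-- A walk leaving `H` passes through one of the two attachment vertices of `H`. -/
theorem exists_mem_support_of_exit {K : SimpleGraph V}
    (hbd : ∀ x ∈ H, ∀ y, K.Adj x y → y ∉ H → y = u ∨ y = v) {x y : V} (p : K.Walk x y)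
    (hx : x ∈ H) (hy : y ∉ H) : ∃ c ∈ p.support, c = u ∨ c = v := by
  obtain ⟨d, hd, h₁, h₂⟩ := p.exists_boundary_dart H hx hy
  exact ⟨d.snd, p.dart_snd_mem_support_of_mem_darts hd, hbd _ h₁ _ d.adj h₂⟩

theorem mem_decompEdges1_of_adj (hbd : ∀ x ∈ H, ∀ y, G.Adj x y → y ∉ H → y = u ∨ y = v)
    {P : G.Walk u v} {a b : V} (hab : G.Adj a b) (h : a ∉ H → b ∉ H → s(a, b) ∈ P.edges) :
    s(a, b) ∈ decompEdges1 P H := by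
  by_cases ha : a ∈ H <;> by_cases hb : b ∈ H
  · refine .inl (.inl ⟨hab, fun t ht => ?_⟩)
    rcases Sym2.mem_iff.1 ht with rfl | rfl <;> assumption
  · exact .inr ⟨a, ha, b, hbd a ha b hab hb, hab, rfl⟩
  · exact .inr ⟨b, hb, a, hbd b hb a hab.symm ha, hab.symm, Sym2.eq_swap⟩
  · exact .inl (.inr (h ha hb))

end Attachments

/-! ### Lex short cycles of lex-convex parts -/

section Decomposition

variable [LinearOrder V] {G : SimpleGraph V} {w : Sym2 V → ℕ}

theorem mem_LSCIn_iff [Finite V] (hconn : G.Connected) {V₁ : Set V} {E₁ : Set (Sym2 V)}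
    (hE : E₁ ⊆ G.edgeSet)
    (hclosed : ∀ x ∈ V₁, ∀ y ∈ V₁, ∀ p : G.Walk x y, IsLexShortestPath w p → WalkIn V₁ E₁ p)
    {C : G.Subgraph} :
    C ∈ LSCIn G w V₁ E₁ ↔ C ∈ LSC G w ∧ C.verts ⊆ V₁ ∧ C.edgeSet ⊆ E₁ := by
  have hrestrict : ∀ x ∈ V₁, ∀ y ∈ V₁, ∀ p : G.Walk x y, IsLexShortestPath w p →
      IsLexShortestPathIn w V₁ E₁ p := fun x hx y hy p hp =>
    ⟨hp.1, hclosed x hx y hy p hp, fun q hq hqin =>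
      hp.2.2 q hq ⟨fun _ _ => trivial, fun e he => hE (hqin.2 e he)⟩⟩
  constructor
  · rintro ⟨hv, he, hC, hlex⟩
    exact ⟨⟨Set.subset_univ _, he.trans hE, hC, fun x hx y hy hxy p hp =>
      hlex x hx y hy hxy p (hrestrict x (hv hx) y (hv hy) p hp)⟩, hv, he⟩
  · rintro ⟨⟨_, _, hC, hlex⟩, hv, he⟩
    refine ⟨hv, he, hC, fun x hx y hy hxy p hp => ?_⟩
    obtain ⟨q, hq⟩ := exists_isLexShortestPath (w := w) (hconn.preconnected x y)
    rw [hp.eq (hrestrict x (hv hx) y (hv hy) q hq)]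
    exact hlex x hx y hy hxy q hq

variable {u v : V} {H : Set V} {P : G.Walk u v}

theorem walkIn_decomp1 (hbd : ∀ x ∈ H, ∀ y, G.Adj x y → y ∉ H → y = u ∨ y = v)
    (hP : IsLexShortestPath w P) {x y : V} (hx : x ∈ decompVerts1 P H)
    (hy : y ∈ decompVerts1 P H) {T : G.Walk x y} (hT : IsLexShortestPath w T) :
    WalkIn (decompVerts1 P H) (decompEdges1 P H) T := by
  have hmeet : ∀ {z t : V} (q : G.Walk z t), z ∈ decompVerts1 P H → t ∉ H →
      ∃ c ∈ q.support, c ∈ P.support := by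
    rintro z t q (hz | hz) ht
    · obtain ⟨c, hc, rfl | rfl⟩ := exists_mem_support_of_exit hbd q hz ht
      · exact ⟨c, hc, P.start_mem_support⟩
      · exact ⟨c, hc, P.end_mem_support⟩
    · exact ⟨z, q.start_mem_support, hz⟩
  have hmeet' : ∀ {z t : V} (q : G.Walk t z), z ∈ decompVerts1 P H → t ∉ H →
      ∃ c ∈ q.support, c ∈ P.support := fun q hz ht => by
    simpa using hmeet q.reverse hz ht
  constructor
  · intro t ht
    by_cases htH : t ∈ H
    · exact .inl htH
    obtain ⟨T₁, T₂, rfl⟩ := Walk.mem_support_iff_exists_append.1 ht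
    exact .inr (hP.mem_support_of_append hT (hmeet T₁ hx htH) (hmeet' T₂ hy htH))
  · intro e he
    obtain ⟨a, b, hab, T₁, T₂, rfl, rfl⟩ := exists_append_cons_of_mem_edges he
    exact mem_decompEdges1_of_adj hbd hab fun ha hb =>
      hP.mem_edges_of_append hT (hmeet T₁ hx ha) (hmeet' T₂ hy hb)

theorem walkIn_decomp2 (hbd : ∀ x ∈ H, ∀ y, G.Adj x y → y ∉ H → y = u ∨ y = v)
    (hP : IsLexShortestPath w P) (hPH : ∀ t ∈ P.support, t ∉ H) {x y : V} (hx : x ∉ H)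
    (hy : y ∉ H) {T : G.Walk x y} (hT : IsLexShortestPath w T) :
    WalkIn Hᶜ (edgesWithin G Hᶜ) T := by
  have hmeet : ∀ {z t : V} (q : G.Walk t z), z ∉ H → t ∈ H →
      ∃ c ∈ q.support, c ∈ P.support := by
    intro z t q hz ht
    obtain ⟨c, hc, rfl | rfl⟩ := exists_mem_support_of_exit hbd q ht hz
    · exact ⟨c, hc, P.start_mem_support⟩
    · exact ⟨c, hc, P.end_mem_support⟩
  have hsupp : ∀ t ∈ T.support, t ∉ H := by
    intro t ht htH
    obtain ⟨T₁, T₂, rfl⟩ := Walk.mem_support_iff_exists_append.1 ht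
    exact hPH t (hP.mem_support_of_append hT (by simpa using hmeet T₁.reverse hx htH)
      (hmeet T₂ hy htH)) htH
  exact ⟨hsupp, fun e he => ⟨T.edges_subset_edgeSet he, fun t ht =>
    hsupp t (T.mem_support_of_mem_edges he ht)⟩⟩

/-- A lex short cycle meeting `H` uses only edges of the first part. -/
theorem edgeSet_subset_decompEdges1 [Finite V]
    (hbd : ∀ x ∈ H, ∀ y, G.Adj x y → y ∉ H → y = u ∨ y = v)
    (hP : IsLexShortestPath w P) (hPH : ∀ t ∈ P.support, t ∉ H) {C : G.Subgraph}
    (hC : C ∈ LSC G w) {t : V} (htC : t ∈ C.verts) (htH : t ∈ H) :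
    C.edgeSet ⊆ decompEdges1 P H := by
  obtain ⟨_, _, hcyc, hlex⟩ := hC
  intro e he
  induction e with
  | _ a b =>
  refine mem_decompEdges1_of_adj hbd he.adj_sub fun ha hb => ?_
  by_contra hab
  obtain ⟨Q, hQ, hall, hedges⟩ := hcyc.exists_path he
  have hbdC : ∀ x ∈ H, ∀ y, C.spanningCoe.Adj x y → y ∉ H → y = u ∨ y = v :=
    fun x hx y hxy => hbd x hx y hxy.adj_sub
  obtain ⟨Q₁, Q₂, rfl⟩ := Walk.mem_support_iff_exists_append.1 (hall t htC)
  obtain ⟨c₁, hc₁, hc₁uv⟩ := exists_mem_support_of_exit hbdC Q₁.reverse htH hb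
  obtain ⟨c₂, hc₂, hc₂uv⟩ := exists_mem_support_of_exit hbdC Q₂ htH ha
  rw [Walk.support_reverse, List.mem_reverse] at hc₁
  have hshare : ∀ s ∈ P.support, s ∈ Q₁.support → s ∉ Q₂.support := by
    intro s hsP hs₁ hs₂
    have hst : s ≠ t := fun hst => hPH s hsP (hst ▸ htH)
    exact hQ.ne_of_mem_support_of_append hst hs₁ hs₂ rfl
  have hc₁P : c₁ ∈ P.support := by rcases hc₁uv with rfl | rfl <;> simp
  have hc₁C := mem_verts_of_mem_support_spanningCoe Q₁ (C.edge_vert he.symm) hc₁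
  have hc₂C := mem_verts_of_mem_support_spanningCoe Q₂ htC hc₂
  have hc₁₂ : c₁ ≠ c₂ := by
    rintro rfl
    exact hshare c₁ hc₁P hc₁ hc₂
  obtain ⟨R, hR, hRsupp, hRedges⟩ : ∃ R : G.Walk c₁ c₂, IsLexShortestPath w R ∧
      (∀ s ∈ R.support, s ∈ P.support) ∧ ∀ e ∈ R.edges, e ∈ P.edges := by
    rcases hc₁uv with rfl | rfl <;> rcases hc₂uv with rfl | rfl
    · exact absurd rfl hc₁₂
    · exact ⟨P, hP, by simp, by simp⟩
    · exact ⟨P.reverse, hP.reverse, by simp, by simp⟩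
    · exact absurd rfl hc₁₂
  obtain ⟨d, hd, hd₁, hd₂⟩ := R.exists_boundary_dart {s | s ∈ Q₁.support} hc₁ fun hc₂' =>
    hshare c₂ (hRsupp c₂ R.end_mem_support) hc₂' hc₂
  have hdR : d.edge ∈ R.edges := List.mem_map_of_mem hd
  have hdC := hlex c₁ hc₁C c₂ hc₂C hc₁₂ R hR d.edge hdR
  have hdQ := hedges d.edge hdC fun h => hab (h ▸ hRedges _ hdR)
  rw [Walk.edges_append, List.mem_append] at hdQ
  rcases hdQ with hdQ | hdQ
  · exact hd₂ (Q₁.snd_mem_support_of_mem_edges hdQ)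
  · exact hshare d.fst (hRsupp _ (R.dart_fst_mem_support_of_mem_darts hd)) hd₁
      (Q₂.fst_mem_support_of_mem_edges hdQ)

end Decomposition

variable [Fintype V] [LinearOrder V]

theorem decomp_lsc_disjoint_union
    (G : SimpleGraph V) (w : Sym2 V → ℕ)
    (hconn : G.Connected) (h2t : IsPartialTwoTree G) (hout : ¬ IsOuterplanar G)
    (u v : V) (huv : u ≠ v) (hsep : IsSeparatorPair G u v)
    (hcomp3 : 3 ≤ numComponentsDel G u v)
    (P : G.Walk u v) (hP : IsLexShortestPath w P)
    (H : Set V) (hH : IsComponentOf G {t | t ≠ u ∧ t ≠ v} H)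
    (hHV : ∀ t ∈ P.support, t ∉ H) (hHE : ∀ e ∈ P.edges, e ∉ edgesWithin G H)
    (G₁ G₂ : G.Subgraph)
    (hV₁ : G₁.verts = decompVerts1 P H) (hE₁ : G₁.edgeSet = decompEdges1 P H)
    (hV₂ : G₂.verts = Hᶜ) (hE₂ : G₂.edgeSet = edgesWithin G Hᶜ) :
    LSC G w = LSCIn G w G₁.verts G₁.edgeSet ∪ LSCIn G w G₂.verts G₂.edgeSet ∧
    LSCIn G w G₁.verts G₁.edgeSet ∩ LSCIn G w G₂.verts G₂.edgeSet = ∅ := by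
  have hbd : ∀ x ∈ H, ∀ y, G.Adj x y → y ∉ H → y = u ∨ y = v := by
    intro x hx y hxy hy
    by_contra hne
    exact hy (hH.mem_of_adj hx (not_or.1 hne) hxy)
  have hiff₁ : ∀ C : G.Subgraph, C ∈ LSCIn G w G₁.verts G₁.edgeSet ↔
      C ∈ LSC G w ∧ C.verts ⊆ G₁.verts ∧ C.edgeSet ⊆ G₁.edgeSet := fun C =>
    mem_LSCIn_iff hconn G₁.edgeSet_subset fun x hx y hy p hp => by
      rw [hV₁] at hx hy ⊢
      rw [hE₁]
      exact walkIn_decomp1 hbd hP hx hy hp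
  have hiff₂ : ∀ C : G.Subgraph, C ∈ LSCIn G w G₂.verts G₂.edgeSet ↔
      C ∈ LSC G w ∧ C.verts ⊆ G₂.verts ∧ C.edgeSet ⊆ G₂.edgeSet := fun C =>
    mem_LSCIn_iff hconn G₂.edgeSet_subset fun x hx y hy p hp => by
      rw [hV₂] at hx hy ⊢
      rw [hE₂]
      exact walkIn_decomp2 hbd hP hHV hx hy hp
  constructor
  · ext C
    rw [Set.mem_union, hiff₁, hiff₂, ← and_or_left, iff_self_and]
    intro hC
    by_cases hCH : ∃ t ∈ C.verts, t ∈ H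
    · obtain ⟨t, htC, htH⟩ := hCH
      have hsub : C.edgeSet ⊆ G₁.edgeSet :=
        hE₁ ▸ edgeSet_subset_decompEdges1 hbd hP hHV hC htC htH
      refine .inl ⟨fun x hx => ?_, hsub⟩
      obtain ⟨y, hxy⟩ := hC.2.2.1.exists_adj hx
      exact G₁.mem_verts_of_mem_edge (hsub hxy) (Sym2.mem_mk_left x y)
    · push Not at hCH
      refine .inr ⟨hV₂ ▸ hCH, fun e he => ?_⟩
      rw [hE₂]
      exact ⟨C.edgeSet_subset he, fun t ht => hCH t (C.mem_verts_of_mem_edge he ht)⟩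
  · rw [Set.eq_empty_iff_forall_notMem]
    rintro C ⟨hC₁, hC₂⟩
    rw [hiff₁] at hC₁
    rw [hiff₂, hE₂] at hC₂
    refine hC₁.1.2.2.1.not_edgeSet_subset_edges hP.isPath fun e he => ?_
    have he₁ := hC₁.2.2 he
    have he₂ := (hC₂.2.2 he).2
    rw [hE₁] at he₁
    rcases he₁ with (he₁ | he₁) | ⟨a, ha, c, _, _, rfl⟩
    · induction e with
      | _ x y => exact absurd (he₁.2 x (Sym2.mem_mk_left x y)) (he₂ x (Sym2.mem_mk_left x y))
    · exact he₁
    · exact absurd ha (he₂ a (Sym2.mem_mk_left a c))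

end LexMCB
end

section
/- Let n ≥ 4 and let G_n = K₁ + C_{n−1} be the wheel graph on n vertices, with edge weights a on every edge of the outer cycle C_{n−1} and b on every spoke (edge incident to the hub), where a, b are positive integers with b sufficiently large relative to a (e.g., 2b > (n−2)·a). Then every face of the planar embedding of G_n (each triangle formed by two spokes and one rim edge, and the outer cycle C_{n−1}) is a lex short cycle, so |LSC(G_n)| = m − n + 2 where m = |E(G_n)|, and hence LSC(G_n) is not a cycle basis of G_n. -/
/-!
Common definitions for formalizing "Minimum Cycle Basis in Weighted Partial 2-trees".
-/

namespace LexMCB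

open SimpleGraph

variable {V : Type*}

/-! ### The wheel graph `K₁ + C_{n-1}` -/

/-- The wheel graph on `Fin n`: the hub `0` is adjacent to every rim vertex, and the rim
vertices `1, …, n-1` form a cycle `C_{n-1}`. -/
def wheel (n : ℕ) : SimpleGraph (Fin n) :=
  SimpleGraph.fromRel fun i j =>
    i.val = 0 ∨ (0 < i.val ∧ 0 < j.val ∧ (j.val = i.val + 1 ∨ (i.val = 1 ∧ j.val = n - 1)))

/-- A triangle face of the wheel: two spokes together with one rim edge. -/
def IsTriangleFace {n : ℕ} [NeZero n] (C : (wheel n).Subgraph) : Prop :=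
  ∃ i j : Fin n, (wheel n).Adj i j ∧ i ≠ 0 ∧ j ≠ 0 ∧
    C.verts = {0, i, j} ∧ C.edgeSet = {s((0 : Fin n), i), s((0 : Fin n), j), s(i, j)}

/-- The outer face of the wheel: the rim cycle `C_{n-1}`. -/
def IsOuterFace {n : ℕ} [NeZero n] (C : (wheel n).Subgraph) : Prop :=
  C.verts = {t : Fin n | t ≠ 0} ∧
    C.edgeSet = {e | e ∈ (wheel n).edgeSet ∧ (0 : Fin n) ∉ e}

/-! ### Path weights in the wheel -/

lemma walkWeight_cons_s16 {G : SimpleGraph V} (w : Sym2 V → ℕ) {x y z : V} (h : G.Adj x y)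
    (p : G.Walk y z) : walkWeight w (Walk.cons h p) = w s(x, y) + walkWeight w p := by
  simp [walkWeight]

lemma walkWeight_append_s16 {G : SimpleGraph V} (w : Sym2 V → ℕ) {x y z : V}
    (p : G.Walk x y) (q : G.Walk y z) :
    walkWeight w (p.append q) = walkWeight w p + walkWeight w q := by
  simp [walkWeight, Walk.edges_append]

lemma walkWeight_reverse_s16 {G : SimpleGraph V} (w : Sym2 V → ℕ) {x y : V} (p : G.Walk x y) :
    walkWeight w p.reverse = walkWeight w p := by
  simp [walkWeight, Walk.edges_reverse, List.sum_reverse]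

lemma walkWeight_toWalk {G : SimpleGraph V} (w : Sym2 V → ℕ) {x y : V} (h : G.Adj x y) :
    walkWeight w h.toWalk = w s(x, y) := by
  simp [walkWeight]

lemma edges_eq_of_length_eq_one {G : SimpleGraph V} {x y : V} {p : G.Walk x y}
    (hp : p.length = 1) : p.edges = [s(x, y)] := by
  cases p with
  | nil => simp at hp
  | cons h q => cases q with
    | nil => simp
    | cons h' q => simp at hp

lemma eq_toWalk_of_length_eq_one {G : SimpleGraph V} {x y : V} {p : G.Walk x y}
    (hp : p.length = 1) (h : G.Adj x y) : p = h.toWalk := by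
  cases p with
  | nil => simp at hp
  | cons h q => cases q with
    | nil => rfl
    | cons h' q => simp at hp

lemma walkIn_univ {G : SimpleGraph V} {x y : V} (p : G.Walk x y) :
    WalkIn Set.univ G.edgeSet p :=
  ⟨fun _ _ => trivial, fun _ he => p.edges_subset_edgeSet he⟩

lemma LexBetter.walkWeight_le [LinearOrder V] {G : SimpleGraph V} {w : Sym2 V → ℕ} {x y : V}
    {p q : G.Walk x y} (h : LexBetter w p q) : walkWeight w p ≤ walkWeight w q := by
  rcases h with h | h | h
  · exact h.le
  · exact h.1.ge
  · exact h.1.ge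

lemma IsLexShortestPathIn.walkWeight_le [LinearOrder V] {G : SimpleGraph V} {w : Sym2 V → ℕ}
    {x y : V} {p : G.Walk x y} (h : IsLexShortestPathIn w Set.univ G.edgeSet p)
    {q : G.Walk x y} (hq : q.IsPath) : walkWeight w p ≤ walkWeight w q := by
  by_cases hqp : q = p
  · rw [hqp]
  · exact (h.2.2 q hq (walkIn_univ q) hqp).walkWeight_le

/-- The weight `w` takes the value `a` on rim edges and `b` on spokes. -/
def IsWheelWeight {n : ℕ} [NeZero n] (a b : ℕ) (w : Sym2 (Fin n) → ℕ) : Prop :=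
  (∀ e ∈ (wheel n).edgeSet, (0 : Fin n) ∉ e → w e = a) ∧
    ∀ e ∈ (wheel n).edgeSet, (0 : Fin n) ∈ e → w e = b

lemma wheel_adj_zero {n : ℕ} [NeZero n] {x : Fin n} (hx : x ≠ 0) : (wheel n).Adj 0 x := by
  simp [wheel, hx.symm]

section Weights

variable {n : ℕ} [NeZero n] {a b : ℕ} {w : Sym2 (Fin n) → ℕ}

lemma le_walkWeight_to_zero (hw : IsWheelWeight a b w) {x y : Fin n} (p : (wheel n).Walk x y)
    (hx : x ≠ 0) (hy : y = 0) : b ≤ walkWeight w p := by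
  induction p with
  | nil => exact absurd hy hx
  | @cons x z y h q ih =>
    rw [walkWeight_cons_s16]
    by_cases hz : z = 0
    · rw [hw.2 s(x, z) h (by simp [hz])]
      omega
    · exact (ih hz hy).trans (Nat.le_add_left _ _)

lemma wheelWeight_pos (hw : IsWheelWeight a b w) (ha : 0 < a) (hb : 0 < b) {x y : Fin n}
    (h : (wheel n).Adj x y) : 0 < w s(x, y) := by
  by_cases h0 : (0 : Fin n) ∈ s(x, y)
  · rw [hw.2 _ h h0]; exact hb
  · rw [hw.1 _ h h0]; exact ha

lemma lt_walkWeight_to_zero (hw : IsWheelWeight a b w) (ha : 0 < a) (hb : 0 < b) {x : Fin n}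
    (hx : x ≠ 0) {p : (wheel n).Walk x 0} (hp : p.IsPath) (hl : p.length ≠ 1) :
    b < walkWeight w p := by
  cases p with
  | nil => exact absurd rfl hx
  | @cons _ z _ h q =>
    rw [Walk.cons_isPath_iff] at hp
    by_cases hz : z = 0
    · subst hz
      rw [Walk.length_cons, Walk.length_eq_zero_iff.2 (Walk.isPath_iff_nil.1 hp.1)] at hl
      exact absurd rfl hl
    · rw [walkWeight_cons_s16]
      have := le_walkWeight_to_zero hw q hz rfl
      have := wheelWeight_pos hw ha hb h
      omega

lemma two_mul_le_walkWeight (hw : IsWheelWeight a b w) {x y : Fin n} (hx : x ≠ 0) (hy : y ≠ 0)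
    {p : (wheel n).Walk x y} (hp : 0 ∈ p.support) : 2 * b ≤ walkWeight w p := by
  rw [← p.take_spec hp, walkWeight_append_s16, ← walkWeight_reverse_s16 w (p.dropUntil 0 hp)]
  have := le_walkWeight_to_zero hw (p.takeUntil 0 hp) hx rfl
  have := le_walkWeight_to_zero hw (p.dropUntil 0 hp).reverse hy rfl
  omega

lemma walkWeight_of_zero_notMem (hw : IsWheelWeight a b w) {x y : Fin n}
    {p : (wheel n).Walk x y} (hp : 0 ∉ p.support) : walkWeight w p = p.length * a := by
  induction p with
  | nil => simp [walkWeight]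
  | @cons x z y h q ih =>
    simp only [Walk.support_cons, List.mem_cons, not_or] at hp
    have hz : 0 ≠ z := fun hz => hp.2 (hz ▸ q.start_mem_support)
    rw [walkWeight_cons_s16, ih hp.2, hw.1 s(x, z) h (by simp [hp.1, hz]), Walk.length_cons]
    ring

lemma lt_walkWeight_of_adj (hw : IsWheelWeight a b w) (hn : 4 ≤ n) (ha : 0 < a) (hb : 0 < b)
    (hab : (n - 2) * a < 2 * b) {x y : Fin n} (h : (wheel n).Adj x y)
    {p : (wheel n).Walk x y} (hp : p.IsPath) (hl : p.length ≠ 1) :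
    w s(x, y) < walkWeight w p := by
  by_cases hy : y = 0
  · subst hy
    rw [hw.2 _ h (by simp)]
    exact lt_walkWeight_to_zero hw ha hb h.ne hp hl
  by_cases hx : x = 0
  · subst hx
    rw [hw.2 _ h (by simp), ← walkWeight_reverse_s16]
    exact lt_walkWeight_to_zero hw ha hb h.ne' hp.reverse (by simpa using hl)
  rw [hw.1 _ h (by simp [Ne.symm hx, Ne.symm hy])]
  by_cases h0 : 0 ∈ p.support
  · have h2 : 2 * a ≤ (n - 2) * a := Nat.mul_le_mul_right a (by omega)
    have := two_mul_le_walkWeight hw hx hy h0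
    omega
  · rw [walkWeight_of_zero_notMem hw h0]
    have hl0 : p.length ≠ 0 := fun h' => h.ne (Walk.eq_of_length_eq_zero h')
    have h2 : 2 * a ≤ p.length * a := Nat.mul_le_mul_right a (by omega)
    omega

lemma edges_eq_of_isLexShortestPathIn (hw : IsWheelWeight a b w) (hn : 4 ≤ n) (ha : 0 < a)
    (hb : 0 < b) (hab : (n - 2) * a < 2 * b) {x y : Fin n} (h : (wheel n).Adj x y)
    {p : (wheel n).Walk x y} (hp : IsLexShortestPathIn w Set.univ (wheel n).edgeSet p) :
    p.edges = [s(x, y)] := by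
  apply edges_eq_of_length_eq_one
  by_contra hl
  have h1 := lt_walkWeight_of_adj hw hn ha hb hab h hp.1 hl
  have h2 := hp.walkWeight_le (Walk.IsPath.of_adj h)
  rw [walkWeight_toWalk] at h2
  omega

lemma isLexShortestPathIn_toWalk (hw : IsWheelWeight a b w) (hn : 4 ≤ n) (ha : 0 < a)
    (hb : 0 < b) (hab : (n - 2) * a < 2 * b) {x y : Fin n} (h : (wheel n).Adj x y) :
    IsLexShortestPathIn w Set.univ (wheel n).edgeSet h.toWalk := by
  refine ⟨Walk.IsPath.of_adj h, walkIn_univ _, fun q hq _ hne => Or.inl ?_⟩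
  rw [walkWeight_toWalk]
  exact lt_walkWeight_of_adj hw hn ha hb hab h hq
    fun hl => hne (eq_toWalk_of_length_eq_one hl h)

lemma zero_notMem_support_of_isLexShortestPathIn (hw : IsWheelWeight a b w)
    (hab : (n - 2) * a < 2 * b) {C : (wheel n).Subgraph} (hC : C.Connected)
    (hverts : C.verts = {t : Fin n | t ≠ 0}) {x y : Fin n} (hx : x ≠ 0) (hy : y ≠ 0)
    {p : (wheel n).Walk x y} (hp : IsLexShortestPathIn w Set.univ (wheel n).edgeSet p) :
    0 ∉ p.support := by
  intro h0
  have h1 := two_mul_le_walkWeight hw hx hy h0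
  obtain ⟨r, hr⟩ := (hC.coe ⟨x, by rw [hverts]; exact hx⟩
    ⟨y, by rw [hverts]; exact hy⟩).exists_isPath
  let q : (wheel n).Walk x y := r.map C.hom
  have hq : q.IsPath := hr.map Subgraph.hom_injective
  have hq0 : 0 ∉ q.support := by
    intro h
    obtain ⟨t, -, ht⟩ := List.mem_map.1 ((Walk.support_map C.hom r) ▸ h)
    exact hverts.subset t.2 ht
  have hlen : q.length + 1 ≤ n - 1 := by
    rw [← Walk.length_support, ← List.toFinset_card_of_nodup hq.support_nodup]
    calc q.support.toFinset.card ≤ (Finset.univ.erase (0 : Fin n)).card := by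
          apply Finset.card_le_card
          intro t ht
          rw [List.mem_toFinset] at ht
          exact Finset.mem_erase.2 ⟨fun h => hq0 (h ▸ ht), Finset.mem_univ t⟩
      _ = n - 1 := by simp
  have h2 := hp.walkWeight_le hq
  rw [walkWeight_of_zero_notMem hw hq0] at h2
  have h3 : q.length * a ≤ (n - 2) * a := Nat.mul_le_mul_right a (by omega)
  omega

end Weights

/-! ### The faces of the wheel -/

lemma subgraph_ext_edgeSet {G : SimpleGraph V} {C D : G.Subgraph} (hv : C.verts = D.verts)
    (he : C.edgeSet = D.edgeSet) : C = D := by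
  refine Subgraph.ext hv ?_
  ext x y
  rw [← Subgraph.mem_edgeSet, he, Subgraph.mem_edgeSet]

/-- The triangle subgraph of the wheel spanned by the hub and the vertices `x`, `y`. -/
def triangle {n : ℕ} [NeZero n] (x y : Fin n) : (wheel n).Subgraph :=
  (⊤ : (wheel n).Subgraph).induce {0, x, y}

/-- The rim cycle of the wheel. -/
def rim (n : ℕ) [NeZero n] : (wheel n).Subgraph :=
  (⊤ : (wheel n).Subgraph).induce {t | t ≠ 0}

section Faces

variable {n : ℕ} [NeZero n]

lemma isOuterFace_iff {C : (wheel n).Subgraph} : IsOuterFace C ↔ C = rim n := by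
  have h : IsOuterFace (rim n) := by
    refine ⟨rfl, ?_⟩
    ext e
    induction e with
    | _ x y => simp [rim, eq_comm, and_assoc, and_comm]
  exact ⟨fun hC => subgraph_ext_edgeSet (hC.1.trans h.1.symm) (hC.2.trans h.2.symm),
    fun hC => hC ▸ h⟩

lemma edgeSet_triangle {x y : Fin n} (h : (wheel n).Adj x y) (hx : x ≠ 0) (hy : y ≠ 0) :
    (triangle x y).edgeSet = {s((0 : Fin n), x), s((0 : Fin n), y), s(x, y)} := by
  have h1 := wheel_adj_zero hx
  have h2 := wheel_adj_zero hy
  ext e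
  induction e with
  | _ u v =>
    simp only [triangle, Subgraph.mem_edgeSet, Subgraph.induce_adj, Set.mem_insert_iff,
      Set.mem_singleton_iff, Subgraph.top_adj, Sym2.eq_iff]
    constructor
    · rintro ⟨rfl | rfl | rfl, rfl | rfl | rfl, h'⟩ <;> simp at h' ⊢
    · rintro ((⟨rfl, rfl⟩ | ⟨rfl, rfl⟩) | (⟨rfl, rfl⟩ | ⟨rfl, rfl⟩) | (⟨rfl, rfl⟩ | ⟨rfl, rfl⟩)) <;>
        simp [h, h1, h2, h.symm, h1.symm, h2.symm]

lemma isTriangleFace_iff {C : (wheel n).Subgraph} : IsTriangleFace C ↔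
    ∃ x y : Fin n, (wheel n).Adj x y ∧ x ≠ 0 ∧ y ≠ 0 ∧ C = triangle x y := by
  constructor
  · rintro ⟨x, y, h, hx, hy, hv, he⟩
    exact ⟨x, y, h, hx, hy, subgraph_ext_edgeSet hv (he.trans (edgeSet_triangle h hx hy).symm)⟩
  · rintro ⟨x, y, h, hx, hy, rfl⟩
    exact ⟨x, y, h, hx, hy, rfl, edgeSet_triangle h hx hy⟩

lemma triangle_comm (x y : Fin n) : triangle x y = triangle y x := by
  rw [triangle, triangle, Set.pair_comm]

lemma isCycleSubgraph_triangle {x y : Fin n} (h : (wheel n).Adj x y) (hx : x ≠ 0) (hy : y ≠ 0) :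
    IsCycleSubgraph (triangle x y) := by
  have h1 := wheel_adj_zero hx
  have h2 := wheel_adj_zero hy
  have hxy := h.ne
  have hadj : ∀ u ∈ (triangle x y).verts, ∀ v ∈ (triangle x y).verts, u ≠ v →
      (triangle x y).Adj u v := by
    intro u hu v hv huv
    refine ⟨hu, hv, ?_⟩
    rcases hu with rfl | rfl | rfl <;> rcases hv with rfl | rfl | rfl <;>
      simp_all [h.symm, h1.symm, h2.symm]
  refine ⟨Subgraph.connected_iff.2 ⟨⟨fun u v => ?_⟩, 0, Or.inl rfl⟩, fun t ht => ?_⟩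
  · by_cases huv : u = v
    · rw [huv]
    · exact Adj.reachable (hadj u u.2 v v.2 fun h' => huv (Subtype.ext h'))
  · have : (triangle x y).neighborSet t = (triangle x y).verts \ {t} := by
      ext v
      exact ⟨fun hv => ⟨Subgraph.Adj.snd_mem hv, ((triangle x y).adj_sub hv).ne'⟩, fun hv => hadj t ht v hv.1 (Ne.symm hv.2)⟩
    rw [this, Set.ncard_sdiff_singleton_of_mem ht]
    change Set.ncard {0, x, y} - 1 = 2
    rw [Set.ncard_eq_three.2 ⟨0, x, y, hx.symm, hy.symm, hxy, rfl⟩]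

variable {a b : ℕ} {w : Sym2 (Fin n) → ℕ}

lemma triangle_mem_LSC (hw : IsWheelWeight a b w) (hn : 4 ≤ n) (ha : 0 < a)
    (hb : 0 < b) (hab : (n - 2) * a < 2 * b) {x y : Fin n} (h : (wheel n).Adj x y)
    (hx : x ≠ 0) (hy : y ≠ 0) : triangle x y ∈ LSC (wheel n) w := by
  have h1 := wheel_adj_zero hx
  have h2 := wheel_adj_zero hy
  refine ⟨Set.subset_univ _, Subgraph.edgeSet_subset _, isCycleSubgraph_triangle h hx hy, ?_⟩
  intro u hu v hv huv p hp e he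
  have huv' : (wheel n).Adj u v := by
    rcases hu with rfl | rfl | rfl <;> rcases hv with rfl | rfl | rfl <;>
      simp_all [h.symm, h1.symm, h2.symm]
  rw [edges_eq_of_isLexShortestPathIn hw hn ha hb hab huv' hp, List.mem_singleton] at he
  rw [he]
  exact ⟨hu, hv, huv'⟩

lemma rim_mem_LSC (hw : IsWheelWeight a b w) (hab : (n - 2) * a < 2 * b)
    (hC : IsCycleSubgraph (rim n)) : rim n ∈ LSC (wheel n) w := by
  refine ⟨Set.subset_univ _, Subgraph.edgeSet_subset _, hC, ?_⟩
  intro u hu v hv _ p hp e he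
  have h0 := zero_notMem_support_of_isLexShortestPathIn hw hab hC.1 rfl hu hv hp
  induction e with
  | _ s t =>
    refine ⟨fun h => h0 (h ▸ p.fst_mem_support_of_mem_edges he),
      fun h => h0 (h ▸ p.snd_mem_support_of_mem_edges he), p.edges_subset_edgeSet he⟩

lemma isTriangleFace_of_mem_LSC (hw : IsWheelWeight a b w) (hn : 4 ≤ n) (ha : 0 < a)
    (hb : 0 < b) (hab : (n - 2) * a < 2 * b) {C : (wheel n).Subgraph}
    (hC : C ∈ LSC (wheel n) w) (h0 : 0 ∈ C.verts) : IsTriangleFace C := by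
  obtain ⟨-, -, ⟨-, hdeg⟩, hlsp⟩ := hC
  have hspoke : ∀ v ∈ C.verts, v ≠ 0 → C.Adj 0 v := fun v hv hv0 =>
    hlsp 0 h0 v hv hv0.symm (wheel_adj_zero hv0).toWalk
      (isLexShortestPathIn_toWalk hw hn ha hb hab _) s(0, v) (by simp)
  obtain ⟨x, y, hxy, hnb⟩ := Set.ncard_eq_two.1 (hdeg 0 h0)
  have hx : C.Adj 0 x := by
    rw [← Subgraph.mem_neighborSet, hnb]; simp
  have hy : C.Adj 0 y := by
    rw [← Subgraph.mem_neighborSet, hnb]; simp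
  have hverts : C.verts = {0, x, y} := by
    ext v
    constructor
    · intro hv
      by_cases hv0 : v = 0
      · exact Or.inl hv0
      · refine Or.inr ?_
        rw [← hnb]
        exact hspoke v hv hv0
    · rintro (rfl | rfl | rfl)
      exacts [h0, hx.snd_mem, hy.snd_mem]
  have hsub : C.neighborSet x ⊆ {0, y} := by
    intro v hv
    have := hverts ▸ hv.snd_mem
    rcases this with rfl | rfl | rfl
    · simp
    · exact absurd rfl hv.ne
    · simp
  have hxy' : C.Adj x y := by
    rw [← Subgraph.mem_neighborSet, Set.eq_of_subset_of_ncard_le hsub]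
    · simp
    · rw [hdeg x hx.snd_mem, Set.ncard_pair hy.ne]
  refine isTriangleFace_iff.2 ⟨x, y, hxy'.adj_sub, hx.ne.symm, hy.ne.symm, ?_⟩
  refine subgraph_ext_edgeSet hverts ?_
  rw [edgeSet_triangle hxy'.adj_sub hx.ne.symm hy.ne.symm]
  apply Set.Subset.antisymm
  · rw [← edgeSet_triangle hxy'.adj_sub hx.ne.symm hy.ne.symm]
    intro e he
    induction e with
    | _ u v =>
      exact ⟨hverts ▸ Subgraph.Adj.fst_mem he, hverts ▸ Subgraph.Adj.snd_mem he,
        Subgraph.Adj.adj_sub he⟩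
  · rintro e (rfl | rfl | rfl)
    exacts [hx, hy, hxy']

end Faces

/-! ### The cyclic structure of the rim -/

section Rim

variable {k : ℕ}

lemma wheel_adj_succ {i j : Fin (k + 3)} :
    (wheel (k + 4)).Adj i.succ j.succ ↔ j = i + 1 ∨ i = j + 1 := by
  simp only [wheel, fromRel_adj, ne_eq, Fin.val_succ, Fin.ext_iff, Fin.val_add_one,
    Fin.val_last]
  have := i.2
  have := j.2
  constructor
  · intro h
    split_ifs <;> omega
  · intro h
    split_ifs at h <;> omega

lemma fin_add_one_ne (i : Fin (k + 3)) : i + 1 ≠ i := by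
  simp only [ne_eq, Fin.ext_iff, Fin.val_add_one, Fin.val_last]
  split_ifs <;> omega

lemma fin_add_one_add_one_ne (i : Fin (k + 3)) : i + 1 + 1 ≠ i := by
  simp only [ne_eq, Fin.ext_iff, Fin.val_add_one, Fin.val_last]
  split_ifs <;> omega

lemma wheel_adj_add_one (i : Fin (k + 3)) : (wheel (k + 4)).Adj i.succ (i + 1).succ :=
  wheel_adj_succ.2 (Or.inl rfl)

lemma neighborSet_subset {C : (wheel (k + 4)).Subgraph} (h0 : 0 ∉ C.verts) (i : Fin (k + 3)) :
    C.neighborSet i.succ ⊆ {(i + 1).succ, (i - 1).succ} := by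
  intro v hv
  obtain ⟨j, rfl⟩ := Fin.exists_succ_eq.2 fun h : v = 0 => h0 (h ▸ hv.snd_mem)
  rcases wheel_adj_succ.1 (Subgraph.Adj.adj_sub hv) with rfl | rfl
  · simp
  · simp

lemma ncard_rim_pair (i : Fin (k + 3)) :
    ({(i + 1).succ, (i - 1).succ} : Set (Fin (k + 4))).ncard = 2 := by
  apply Set.ncard_pair
  rw [Ne, Fin.succ_inj, eq_sub_iff_add_eq]
  exact fin_add_one_add_one_ne i

lemma isCycleSubgraph_rim : IsCycleSubgraph (rim (k + 4)) := by
  have hadj : ∀ i : Fin (k + 3), (rim (k + 4)).Adj i.succ (i + 1).succ := fun i =>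
    ⟨Fin.succ_ne_zero i, Fin.succ_ne_zero _, wheel_adj_add_one i⟩
  refine ⟨Subgraph.connected_iff.2 ⟨⟨?_⟩, _, (hadj 0).fst_mem⟩, fun t ht => ?_⟩
  · have key : ∀ i : Fin (k + 3), (rim (k + 4)).coe.Reachable ⟨_, (hadj 0).fst_mem⟩
        ⟨_, (hadj i).fst_mem⟩ := by
      intro i
      induction i using Fin.induction with
      | zero => rfl
      | succ i ih =>
        refine ih.trans (Adj.reachable ?_)
        have := hadj i.castSucc
        rwa [Fin.coeSucc_eq_succ] at this
    rintro ⟨u, hu⟩ ⟨v, hv⟩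
    obtain ⟨i, rfl⟩ := Fin.exists_succ_eq.2 hu
    obtain ⟨j, rfl⟩ := Fin.exists_succ_eq.2 hv
    exact (key i).symm.trans (key j)
  · obtain ⟨i, rfl⟩ := Fin.exists_succ_eq.2 ht
    rw [← ncard_rim_pair i]
    congr 1
    refine (neighborSet_subset (C := rim (k + 4)) (fun h => h rfl) i).antisymm ?_
    rintro v (rfl | rfl)
    · exact hadj i
    · have := (hadj (i - 1)).symm
      rwa [sub_add_cancel] at this

lemma eq_rim_of_isCycleSubgraph {C : (wheel (k + 4)).Subgraph} (hC : IsCycleSubgraph C)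
    (h0 : 0 ∉ C.verts) : C = rim (k + 4) := by
  have hstep : ∀ i : Fin (k + 3), i.succ ∈ C.verts → C.Adj i.succ (i + 1).succ := by
    intro i hi
    rw [← Subgraph.mem_neighborSet, Set.eq_of_subset_of_ncard_le (neighborSet_subset h0 i)]
    · simp
    · rw [ncard_rim_pair, hC.2 _ hi]
  have hmem : ∀ i : Fin (k + 3), i.succ ∈ C.verts := by
    obtain ⟨v, hv⟩ := hC.1.nonempty
    obtain ⟨i, rfl⟩ := Fin.exists_succ_eq.2 fun h : v = 0 => h0 (h ▸ hv)
    have key : ∀ j : Fin (k + 3), (i + j).succ ∈ C.verts := by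
      intro j
      induction j using Fin.induction with
      | zero => simpa using hv
      | succ j ih =>
        rw [← Fin.coeSucc_eq_succ (a := j), ← add_assoc]
        exact (hstep _ ih).snd_mem
    intro j
    simpa using key (j - i)
  refine Subgraph.ext ?_ ?_
  · ext v
    constructor
    · exact fun hv h => h0 (h ▸ hv)
    · intro hv
      obtain ⟨i, rfl⟩ := Fin.exists_succ_eq.2 hv
      exact hmem i
  · ext u v
    constructor
    · exact fun h => ⟨fun h' => h0 (h' ▸ h.fst_mem), fun h' => h0 (h' ▸ h.snd_mem), h.adj_sub⟩
    · rintro ⟨hu, hv, h⟩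
      obtain ⟨i, rfl⟩ := Fin.exists_succ_eq.2 hu
      obtain ⟨j, rfl⟩ := Fin.exists_succ_eq.2 hv
      rcases wheel_adj_succ.1 h with rfl | rfl
      · exact hstep i (hmem i)
      · exact (hstep j (hmem j)).symm

/-- The triangle face of the wheel at the `i`-th rim edge. -/
def rimTriangle (i : Fin (k + 3)) : (wheel (k + 4)).Subgraph :=
  triangle i.succ (i + 1).succ

lemma isTriangleFace_iff_rimTriangle {C : (wheel (k + 4)).Subgraph} :
    IsTriangleFace C ↔ ∃ i : Fin (k + 3), rimTriangle i = C := by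
  rw [isTriangleFace_iff]
  constructor
  · rintro ⟨x, y, h, hx, hy, rfl⟩
    obtain ⟨i, rfl⟩ := Fin.exists_succ_eq.2 hx
    obtain ⟨j, rfl⟩ := Fin.exists_succ_eq.2 hy
    rcases wheel_adj_succ.1 h with rfl | rfl
    · exact ⟨i, rfl⟩
    · exact ⟨j, triangle_comm _ _⟩
  · rintro ⟨i, rfl⟩
    exact ⟨_, _, wheel_adj_add_one i, Fin.succ_ne_zero _, Fin.succ_ne_zero _, rfl⟩

lemma rimTriangle_injective : Function.Injective (rimTriangle (k := k)) := by
  intro i j h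
  have hv : ({0, i.succ, (i + 1).succ} : Set (Fin (k + 4))) = {0, j.succ, (j + 1).succ} :=
    congrArg Subgraph.verts h
  have h1 : i.succ ∈ ({0, j.succ, (j + 1).succ} : Set (Fin (k + 4))) := by rw [← hv]; simp
  have h2 : (i + 1).succ ∈ ({0, j.succ, (j + 1).succ} : Set (Fin (k + 4))) := by rw [← hv]; simp
  simp only [Set.mem_insert_iff, Fin.succ_ne_zero, Set.mem_singleton_iff, Fin.succ_inj,
    false_or] at h1 h2
  rcases h1 with h1 | rfl
  · exact h1
  · rcases h2 with h2 | h2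
    · exact absurd h2 (fin_add_one_add_one_ne j)
    · exact absurd h2 (fin_add_one_ne _)

lemma rim_notMem_range_rimTriangle : rim (k + 4) ∉ Set.range (rimTriangle (k := k)) := by
  rintro ⟨i, hi⟩
  have h : (0 : Fin (k + 4)) ∈ (rimTriangle i).verts := Or.inl rfl
  rw [hi] at h
  exact h rfl

lemma rimEdge_injective :
    Function.Injective fun i : Fin (k + 3) => s(i.succ, (i + 1).succ) := by
  intro i j h
  rcases Sym2.eq_iff.1 h with ⟨h1, -⟩ | ⟨h1, h2⟩
  · exact Fin.succ_inj.1 h1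
  · rw [Fin.succ_inj] at h1 h2
    rw [h1] at h2
    exact absurd h2 (fin_add_one_add_one_ne j)

lemma edgeSet_rim :
    (rim (k + 4)).edgeSet = Set.range fun i : Fin (k + 3) => s(i.succ, (i + 1).succ) := by
  ext e
  constructor
  · induction e with
    | _ u v =>
      rintro ⟨hu, hv, h⟩
      obtain ⟨i, rfl⟩ := Fin.exists_succ_eq.2 hu
      obtain ⟨j, rfl⟩ := Fin.exists_succ_eq.2 hv
      rcases wheel_adj_succ.1 h with rfl | rfl
      · exact ⟨i, rfl⟩
      · exact ⟨j, Sym2.eq_swap⟩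
  · rintro ⟨i, rfl⟩
    exact Subgraph.mem_edgeSet.2 ⟨Fin.succ_ne_zero i, Fin.succ_ne_zero _, wheel_adj_add_one i⟩

lemma edgeSet_wheel : (wheel (k + 4)).edgeSet =
    (Set.range fun i : Fin (k + 3) => s((0 : Fin (k + 4)), i.succ)) ∪ (rim (k + 4)).edgeSet := by
  ext e
  induction e with
  | _ u v =>
    constructor
    · intro h
      rw [mem_edgeSet] at h
      by_cases hu : u = 0
      · subst hu
        obtain ⟨j, rfl⟩ := Fin.exists_succ_eq.2 h.ne'
        exact Or.inl ⟨j, rfl⟩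
      by_cases hv : v = 0
      · subst hv
        obtain ⟨j, rfl⟩ := Fin.exists_succ_eq.2 h.ne
        exact Or.inl ⟨j, Sym2.eq_swap⟩
      · exact Or.inr ⟨hu, hv, h⟩
    · rintro (⟨i, h⟩ | h)
      · rw [← h]
        exact wheel_adj_zero (Fin.succ_ne_zero i)
      · exact (rim (k + 4)).edgeSet_subset h

lemma ncard_edgeSet_wheel : (wheel (k + 4)).edgeSet.ncard = (k + 3) + (k + 3) := by
  rw [edgeSet_wheel, Set.ncard_union_eq, edgeSet_rim, Set.ncard_range_of_injective,
    Set.ncard_range_of_injective rimEdge_injective, Nat.card_fin]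
  · intro i j h
    simpa using h
  · rw [Set.disjoint_left]
    rintro e ⟨i, rfl⟩ h
    exact h.1 rfl

/-! ### The linear dependence between the faces -/

lemma cycleIncVec_rimTriangle (i : Fin (k + 3)) : cycleIncVec (rimTriangle i) =
    Pi.single s((0 : Fin (k + 4)), i.succ) 1 + Pi.single s((0 : Fin (k + 4)), (i + 1).succ) 1 +
      Pi.single s(i.succ, (i + 1).succ) 1 := by
  have h := edgeSet_triangle (wheel_adj_add_one i) (Fin.succ_ne_zero i) (Fin.succ_ne_zero _)
  have h1 : s((0 : Fin (k + 4)), i.succ) ≠ s((0 : Fin (k + 4)), (i + 1).succ) := by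
    simp
  have h2 : s((0 : Fin (k + 4)), i.succ) ≠ s(i.succ, (i + 1).succ) := by
    simp [(Fin.succ_ne_zero _).symm]
  have h3 : s((0 : Fin (k + 4)), (i + 1).succ) ≠ s(i.succ, (i + 1).succ) := by
    simp [(Fin.succ_ne_zero _).symm]
  rw [cycleIncVec, rimTriangle, h]
  ext e
  simp only [Set.indicator_apply, Set.mem_insert_iff, Set.mem_singleton_iff, Pi.add_apply,
    Pi.single_apply]
  by_cases e1 : e = s((0 : Fin (k + 4)), i.succ)
  · simp [e1, h1, h2]
  by_cases e2 : e = s((0 : Fin (k + 4)), (i + 1).succ)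
  · simp [e2, h1.symm, h3]
  simp [e1, e2]

lemma cycleIncVec_rim : cycleIncVec (rim (k + 4)) =
    ∑ i : Fin (k + 3), Pi.single s(i.succ, (i + 1).succ) (1 : ZMod 2) := by
  rw [cycleIncVec, edgeSet_rim]
  ext e
  rw [Finset.sum_apply]
  by_cases he : e ∈ Set.range fun i : Fin (k + 3) => s(i.succ, (i + 1).succ)
  · rw [Set.indicator_of_mem he]
    obtain ⟨i, rfl⟩ := he
    rw [Finset.sum_eq_single i]
    · simp
    · intro j _ hj
      exact Pi.single_eq_of_ne (fun h => hj (rimEdge_injective h).symm) _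
    · simp
  · rw [Set.indicator_of_notMem he]
    symm
    refine Finset.sum_eq_zero fun i _ => Pi.single_eq_of_ne (fun h => he ⟨i, h.symm⟩) _

lemma sum_cycleIncVec_rimTriangle :
    ∑ i : Fin (k + 3), cycleIncVec (rimTriangle i) = cycleIncVec (rim (k + 4)) := by
  have hshift : ∑ i : Fin (k + 3),
      (Pi.single s((0 : Fin (k + 4)), (i + 1).succ) 1 : Sym2 (Fin (k + 4)) → ZMod 2) =
      ∑ i : Fin (k + 3), Pi.single s((0 : Fin (k + 4)), i.succ) 1 :=
    Equiv.sum_comp (Equiv.addRight (1 : Fin (k + 3)))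
      fun i => (Pi.single s((0 : Fin (k + 4)), i.succ) 1 : Sym2 (Fin (k + 4)) → ZMod 2)
  simp only [cycleIncVec_rimTriangle, Finset.sum_add_distrib]
  rw [hshift, ← cycleIncVec_rim, CharTwo.add_self_eq_zero, zero_add]

lemma span_insert_rim :
    Submodule.span (ZMod 2) (cycleIncVec '' insert (rim (k + 4)) (Set.range (rimTriangle (k := k))))
      = Submodule.span (ZMod 2) (cycleIncVec '' Set.range (rimTriangle (k := k))) := by
  rw [Set.image_insert_eq]
  apply Submodule.span_insert_eq_span
  rw [← sum_cycleIncVec_rimTriangle]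
  exact Submodule.sum_mem _ fun i _ => Submodule.subset_span ⟨_, ⟨i, rfl⟩, rfl⟩

lemma LSC_wheel {a b : ℕ} {w : Sym2 (Fin (k + 4)) → ℕ} (hw : IsWheelWeight a b w) (ha : 0 < a)
    (hb : 0 < b) (hab : (k + 4 - 2) * a < 2 * b) :
    LSC (wheel (k + 4)) w = insert (rim (k + 4)) (Set.range (rimTriangle (k := k))) := by
  have hn : 4 ≤ k + 4 := Nat.le_add_left 4 k
  ext C
  constructor
  · intro hC
    by_cases h0 : 0 ∈ C.verts
    · exact Or.inr (isTriangleFace_iff_rimTriangle.1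
        (isTriangleFace_of_mem_LSC hw hn ha hb hab hC h0))
    · exact Or.inl (eq_rim_of_isCycleSubgraph hC.2.2.1 h0)
  · rintro (rfl | ⟨i, rfl⟩)
    · exact rim_mem_LSC hw hab isCycleSubgraph_rim
    · exact triangle_mem_LSC hw hn ha hb hab (wheel_adj_add_one i) (Fin.succ_ne_zero _)
        (Fin.succ_ne_zero _)

lemma ncard_insert_rim :
    (insert (rim (k + 4)) (Set.range (rimTriangle (k := k)))).ncard = k + 4 := by
  rw [Set.ncard_insert_of_notMem rim_notMem_range_rimTriangle (Set.finite_range _),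
    Set.ncard_range_of_injective rimTriangle_injective, Nat.card_fin]

lemma not_isCycleBasis_insert_rim :
    ¬ IsCycleBasis (wheel (k + 4)) (insert (rim (k + 4)) (Set.range (rimTriangle (k := k)))) := by
  rintro ⟨hcyc, hspan, hmin⟩
  have h := hmin _ (fun C hC => hcyc C (Or.inr hC)) (span_insert_rim.symm.trans hspan)
  rw [ncard_insert_rim, Set.ncard_range_of_injective rimTriangle_injective, Nat.card_fin] at h
  omega

end Rim

theorem wheel_faces_lexShort_and_lsc_not_cycleBasis
    (n : ℕ) [NeZero n] (hn : 4 ≤ n) (a b : ℕ) (ha : 0 < a) (hb : 0 < b)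
    (hab : (n - 2) * a < 2 * b) (w : Sym2 (Fin n) → ℕ)
    (hwrim : ∀ e ∈ (wheel n).edgeSet, (0 : Fin n) ∉ e → w e = a)
    (hwspoke : ∀ e ∈ (wheel n).edgeSet, (0 : Fin n) ∈ e → w e = b) :
    (∀ C : (wheel n).Subgraph, IsTriangleFace C ∨ IsOuterFace C → C ∈ LSC (wheel n) w) ∧
    (LSC (wheel n) w).ncard = (wheel n).edgeSet.ncard + 2 - n ∧
    ¬ IsCycleBasis (wheel n) (LSC (wheel n) w) := by
  have hw : IsWheelWeight a b w := ⟨hwrim, hwspoke⟩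
  obtain ⟨k, rfl⟩ : ∃ k, n = k + 4 := ⟨n - 4, by omega⟩
  have hLSC := LSC_wheel hw ha hb hab
  refine ⟨fun C hC => ?_, ?_, ?_⟩
  · rw [hLSC]
    rcases hC with hC | hC
    · exact Or.inr (isTriangleFace_iff_rimTriangle.1 hC)
    · exact Or.inl (isOuterFace_iff.1 hC)
  · rw [hLSC, ncard_insert_rim, ncard_edgeSet_wheel]
    omega
  · rw [hLSC]
    exact not_isCycleBasis_insert_rim

end LexMCB
end

section
/- Let G be a connected weighted partial 2-tree that is not outerplanar, let {u,v} be a vertex separator of G, let H be a component of G − {u,v} with V(lsp(u,v)) ∩ V(H) = ∅ and E(lsp(u,v)) ∩ E(H) = ∅, and let G₁, G₂ be obtained by decomp(G,u,v). Then E(G₁) ∩ E(G₂) = E(lsp(u,v)), and both G₁ and G₂ are connected partial 2-trees. -/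
/-!
Common definitions for formalizing "Minimum Cycle Basis in Weighted Partial 2-trees".
-/

namespace LexMCB

open SimpleGraph

variable {V : Type*}

/-- A proper nonempty vertex set of a connected graph has an edge leaving it. -/
theorem exists_adj_notMem {G : SimpleGraph V} (hG : G.Connected) {S : Set V}
    (hS : S.Nonempty) {u : V} (hu : u ∉ S) : ∃ x ∈ S, ∃ y ∉ S, G.Adj x y := by
  obtain ⟨x, hx⟩ := hS
  obtain ⟨p⟩ := hG.preconnected x u
  obtain ⟨d, -, h₁, h₂⟩ := p.exists_boundary_dart S hx hu
  exact ⟨d.fst, h₁, d.snd, h₂, d.adj⟩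

/-- An edge leaving a component of `G[A]` leaves `A`. -/
theorem IsComponentOf.notMem_of_adj {G : SimpleGraph V} {A H : Set V}
    (hH : IsComponentOf G A H) {x y : V} (hx : x ∈ H) (hy : y ∉ H) (hxy : G.Adj x y) :
    y ∉ A := by
  intro hyA
  have hK : (G.induce (H ∪ {x, y})).Connected :=
    induce_union_connected hH.2.2.1.preconnected (induce_pair_connected_of_adj hxy).preconnected
      ⟨x, hx, by simp⟩
  have hsub : H ∪ {x, y} ⊆ A := by
    rintro t (ht | rfl | rfl)
    exacts [hH.2.1 ht, hH.2.1 hx, hyA]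
  have := hH.2.2.2 _ Set.subset_union_left hsub hK
  exact hy (this ▸ Or.inr (by simp))

/-- Partial 2-trees are closed under taking subgraphs. -/
theorem IsPartialTwoTree.coe_subgraph {G : SimpleGraph V} (hG : IsPartialTwoTree G)
    (S : G.Subgraph) : IsPartialTwoTree S.coe := by
  obtain ⟨n, T, f, hT, hf⟩ := hG
  exact ⟨n, T, (Function.Embedding.subtype _).trans f, hT,
    fun x y hxy => hf x y (S.adj_sub hxy)⟩

/-- If all edges leaving `H` end in `{u, v}`, and `u`, `v` are joined by a walk avoiding `H`,
then deleting `H` from a connected graph leaves a connected graph. -/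
theorem connected_induce_compl {G : SimpleGraph V} (hG : G.Connected) {H : Set V} {u v : V}
    (P : G.Walk u v) (hP : ∀ t ∈ P.support, t ∉ H)
    (hH : ∀ x ∈ H, ∀ y ∉ H, G.Adj x y → y = u ∨ y = v) : (G.induce Hᶜ).Connected := by
  have hu : u ∈ Hᶜ := hP u P.start_mem_support
  have hv : v ∈ Hᶜ := hP v P.end_mem_support
  have hvu : (G.induce Hᶜ).Reachable ⟨v, hv⟩ ⟨u, hu⟩ := (P.induce Hᶜ hP).reachable.symm
  have key : ∀ {x z : V} (p : G.Walk x z), z = u →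
      ∀ hx : x ∈ Hᶜ, (G.induce Hᶜ).Reachable ⟨x, hx⟩ ⟨u, hu⟩ := by
    intro x z p
    induction p with
    | nil => rintro rfl hx; rfl
    | @cons a b c hab q ih =>
      intro hz ha
      by_cases hb : b ∈ H
      · obtain rfl | rfl := hH b hb a ha hab.symm
        exacts [.rfl, hvu]
      · have hadj : (G.induce Hᶜ).Adj ⟨a, ha⟩ ⟨b, hb⟩ := hab
        exact hadj.reachable.trans (ih hz hb)
  refine (connected_iff_exists_forall_reachable _).2 ⟨⟨u, hu⟩, fun x => ?_⟩
  obtain ⟨p⟩ := hG.preconnected x.1 u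
  exact (key p rfl x.2).symm

variable [Fintype V] [LinearOrder V]

theorem decomp_edge_inter_and_parts
    (G : SimpleGraph V) (w : Sym2 V → ℕ)
    (hconn : G.Connected) (h2t : IsPartialTwoTree G) (hout : ¬ IsOuterplanar G)
    (u v : V) (huv : u ≠ v) (hsep : IsSeparatorPair G u v)
    (P : G.Walk u v) (hP : IsLexShortestPath w P)
    (H : Set V) (hH : IsComponentOf G {t | t ≠ u ∧ t ≠ v} H)
    (hHV : ∀ t ∈ P.support, t ∉ H) (hHE : ∀ e ∈ P.edges, e ∉ edgesWithin G H)
    (G₁ G₂ : G.Subgraph)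
    (hV₁ : G₁.verts = decompVerts1 P H) (hE₁ : G₁.edgeSet = decompEdges1 P H)
    (hV₂ : G₂.verts = Hᶜ) (hE₂ : G₂.edgeSet = edgesWithin G Hᶜ) :
    G₁.edgeSet ∩ G₂.edgeSet = {e | e ∈ P.edges} ∧
    G₁.Connected ∧ G₂.Connected ∧
    IsPartialTwoTree G₁.coe ∧ IsPartialTwoTree G₂.coe := by
  have hout_adj : ∀ x ∈ H, ∀ y ∉ H, G.Adj x y → y = u ∨ y = v := by
    intro x hx y hy hxy
    have := hH.notMem_of_adj hx hy hxy
    simp only [Set.mem_ofPred_eq] at this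
    tauto
  refine ⟨?_, ?_, ?_, h2t.coe_subgraph G₁, h2t.coe_subgraph G₂⟩
  · rw [hE₁, hE₂]
    ext e
    constructor
    · rintro ⟨(⟨-, he⟩ | he) | ⟨a, ha, c, -, -, rfl⟩, -, he'⟩
      · induction e with
        | h a b => exact absurd (he a (by simp)) (he' a (by simp))
      · exact he
      · exact absurd ha (he' a (by simp))
    · intro he
      exact ⟨.inl (.inr he), P.edges_subset_edgeSet he,
        fun t ht => hHV t (P.mem_support_of_mem_edges he ht)⟩
  · obtain ⟨x, hx, y, hy, hxy⟩ :=
      exists_adj_notMem hconn hH.1 (hHV u P.start_mem_support)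
    have hyuv := hout_adj x hx y hy hxy
    have hyP : y ∈ P.support := by
      obtain rfl | rfl := hyuv
      exacts [P.start_mem_support, P.end_mem_support]
    have hxG : x ∈ G₁.verts := hV₁.ge (.inl hx)
    have hyG : y ∈ G₁.verts := hV₁.ge (.inr hyP)
    have hxyG : G₁.Adj x y :=
      Subgraph.mem_edgeSet.1 (hE₁.ge (.inr ⟨x, hx, y, hyuv, hxy, rfl⟩))
    have hle : (⊤ : G.Subgraph).induce {x, y} ⊔ (⊤ : G.Subgraph).induce H ⊔ P.toSubgraph ≤ G₁ := by
      refine sup_le (sup_le ⟨?_, ?_⟩ ⟨?_, ?_⟩) ⟨?_, ?_⟩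
      · rintro t (rfl | rfl)
        exacts [hxG, hyG]
      · rintro a b ⟨rfl | rfl, rfl | rfl, hab⟩
        exacts [(hab.ne rfl).elim, hxyG, hxyG.symm, (hab.ne rfl).elim]
      · exact fun t ht => hV₁.ge (.inl ht)
      · rintro a b ⟨ha, hb, hab⟩
        refine Subgraph.mem_edgeSet.1 (hE₁.ge (.inl (.inl ⟨hab, fun t ht => ?_⟩)))
        obtain rfl | rfl := Sym2.mem_iff.1 ht
        exacts [ha, hb]
      · exact fun t ht => hV₁.ge (.inr (P.mem_verts_toSubgraph.1 ht))
      · exact fun a b hab =>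
          Subgraph.mem_edgeSet.1 (hE₁.ge (.inl (.inr (P.mem_edges_toSubgraph.1 hab))))
    refine (Subgraph.connected_induce_top_sup (connected_induce_iff.1 hH.2.2.1).preconnected
      P.toSubgraph_connected.preconnected hx (P.mem_verts_toSubgraph.2 hyP) hxy).mono hle
      (hle.1.antisymm ?_)
    rw [hV₁]
    rintro t (ht | ht)
    exacts [.inl (.inr ht), .inr (P.mem_verts_toSubgraph.2 ht)]
  · have hle : (⊤ : G.Subgraph).induce Hᶜ ≤ G₂ := by
      refine ⟨hV₂.ge, fun a b hab => ?_⟩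
      rw [← Subgraph.mem_edgeSet, hE₂]
      simp only [Subgraph.induce_adj, Subgraph.top_adj] at hab
      refine ⟨hab.2.2, fun t ht => ?_⟩
      obtain rfl | rfl := Sym2.mem_iff.1 ht
      exacts [hab.1, hab.2.1]
    exact (connected_induce_iff.1 (connected_induce_compl hconn P hHV hout_adj)).mono hle hV₂.symm

end LexMCB
end
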